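/- arXiv:2603.18215 — 11 statements merged into one kernel-verified Lean document; each statement's English description precedes it below -/
import Mathlib

section
/- For a vector x ∈ ℝⁿ, the rank-one matrix x xᵀ belongs to the k-spartrahedron S_{n,k} if and only if ‖x‖₀ ≤ k. Consequently, the closed convex hull cone conv(Q_{n,k}) is contained in S_{n,k}. -/
open Matrix Finset

/-- Number of nonzero entries of a vector. -/
noncomputable def sparsity {n : ℕ} (x : Fin n → ℝ) : ℕ :=
  (Finset.univ.filter fun i => x i ≠ 0).card

/-- The `k`-spartrahedron: symmetric matrices with `k·diag(X) ⪰ X ⪰ 0`. -/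
def Spartra (n k : ℕ) : Set (Matrix (Fin n) (Fin n) ℝ) :=
  {X | ((k : ℝ) • Matrix.diagonal (fun i => X i i) - X).PosSemidef ∧ X.PosSemidef}

/-- The set of rank-one matrices `x xᵀ` with `‖x‖₀ ≤ k`. -/
def Qset (n k : ℕ) : Set (Matrix (Fin n) (Fin n) ℝ) :=
  {X | ∃ x : Fin n → ℝ, sparsity x ≤ k ∧ X = Matrix.vecMulVec x x}


lemma spartra_quad {n : ℕ} (k : ℕ) (x y : Fin n → ℝ) :
    star y ⬝ᵥ (((k : ℝ) • Matrix.diagonal (fun i => Matrix.vecMulVec x x i i)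
      - Matrix.vecMulVec x x) *ᵥ y) = k * ∑ i, (x i * y i) ^ 2 - (∑ i, x i * y i) ^ 2 := by
  rw [Matrix.sub_mulVec, dotProduct_sub, Matrix.smul_mulVec, dotProduct_smul]
  congr 1
  · simp only [dotProduct, mulVec_diagonal, vecMulVec_apply, smul_eq_mul]
    congr 1
    refine Finset.sum_congr rfl fun i _ => ?_
    simp only [Pi.star_apply, star_trivial]
    ring
  · simp only [dotProduct, mulVec, vecMulVec_apply, Pi.star_apply, star_trivial]
    rw [sq, Finset.sum_mul]
    refine Finset.sum_congr rfl fun i _ => ?_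
    rw [Finset.mul_sum, Finset.mul_sum]
    refine Finset.sum_congr rfl fun j _ => ?_
    ring

lemma spartra_rank_one {n k : ℕ} (x : Fin n → ℝ) :
    Matrix.vecMulVec x x ∈ Spartra n k ↔ sparsity x ≤ k := by
  constructor
  · rintro ⟨h, -⟩
    have h1 := (Matrix.posSemidef_iff_dotProduct_mulVec.1 h).2 (fun i => (x i)⁻¹)
    rw [spartra_quad] at h1
    have e : ∀ i, x i * (x i)⁻¹ = if x i ≠ 0 then (1 : ℝ) else 0 := by
      intro i
      split_ifs with hi
      · exact mul_inv_cancel₀ hi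
      · simp [not_not.1 hi]
    have e1 : ∑ i, x i * (x i)⁻¹ = (sparsity x : ℝ) := by
      rw [Finset.sum_congr rfl fun i _ => e i, Finset.sum_boole]; rfl
    have e2 : ∑ i, (x i * (x i)⁻¹) ^ 2 = (sparsity x : ℝ) := by
      rw [← e1]
      refine Finset.sum_congr rfl fun i _ => ?_
      rw [e i]; split_ifs <;> simp
    rw [e1, e2] at h1
    by_contra! hc
    have hc' : (k : ℝ) < sparsity x := by exact_mod_cast hc
    have : (0 : ℝ) ≤ k := Nat.cast_nonneg k
    nlinarith
  · intro h
    have hp : (Matrix.vecMulVec x x).PosSemidef := by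
      simpa using Matrix.posSemidef_vecMulVec_self_star x
    refine ⟨Matrix.posSemidef_iff_dotProduct_mulVec.2 ⟨?_, fun y => ?_⟩, hp⟩
    · refine Matrix.IsHermitian.sub ?_ hp.1
      ext i j
      by_cases hij : i = j
      · subst hij; simp
      · simp [Matrix.diagonal_apply, hij, Ne.symm hij]
    · rw [spartra_quad]
      have e1 : ∑ i, x i * y i = ∑ i ∈ Finset.univ.filter (fun i => x i ≠ 0), x i * y i := by
        symm
        apply Finset.sum_subset (Finset.filter_subset _ _)
        intro i _ hi
        have : x i = 0 := by simpa using hi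
        simp [this]
      have h2 := sq_sum_le_card_mul_sum_sq (s := Finset.univ.filter (fun i => x i ≠ 0))
        (f := fun i => x i * y i)
      have h3 : ∑ i ∈ Finset.univ.filter (fun i => x i ≠ 0), (x i * y i) ^ 2
          ≤ ∑ i, (x i * y i) ^ 2 :=
        Finset.sum_le_sum_of_subset_of_nonneg (Finset.filter_subset _ _)
          fun i _ _ => sq_nonneg _
      have h4 : (((Finset.univ.filter (fun i => x i ≠ 0)).card : ℕ) : ℝ) ≤ k := by
        exact_mod_cast h
      rw [e1]
      have h5 := mul_le_mul h4 h3 (Finset.sum_nonneg fun i _ => sq_nonneg _) (Nat.cast_nonneg k)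
      linarith

lemma spartra_convex (n k : ℕ) : Convex ℝ (Spartra n k) := by
  rintro A ⟨hA1, hA2⟩ B ⟨hB1, hB2⟩ a b ha hb -
  refine ⟨?_, (hA2.smul ha).add (hB2.smul hb)⟩
  have := (hA1.smul ha).add (hB1.smul hb)
  convert this using 1
  ext i j
  by_cases hij : i = j
  · subst hij; simp; ring
  · simp [hij]; ring

theorem spartra_rank_one_mem_iff (n k : ℕ) (hk : 1 ≤ k) (x : Fin n → ℝ) :
    (Matrix.vecMulVec x x ∈ Spartra n k ↔ sparsity x ≤ k) ∧
    convexHull ℝ (Qset n k) ⊆ Spartra n k := by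
  refine ⟨spartra_rank_one x, convexHull_min ?_ (spartra_convex n k)⟩
  rintro X ⟨y, hy, rfl⟩
  exact (spartra_rank_one y).2 hy
end

section
/- For every n ≥ 4, the inclusion conv(Q_{n,2}) ⊆ S_{n,2} is strict: there exists a matrix X ∈ S_{n,2} with X ∉ conv(Q_{n,2}). -/
open Matrix Finset

def gC (s : ℝ) : ℕ → ℕ → ℝ
  | 0, 0 => 3 | 1, 1 => 3 | 2, 2 => 3 | 3, 3 => 3
  | 0, 1 => s | 1, 0 => s
  | 1, 2 => s | 2, 1 => s
  | 2, 3 => s | 3, 2 => s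
  | 0, 3 => -s | 3, 0 => -s
  | _, _ => 0

theorem gC_symm (s : ℝ) (i j : ℕ) : gC s i j = gC s j i := by
  unfold gC
  split <;> simp_all <;> split <;> simp_all

theorem gC_big (s : ℝ) (i j : ℕ) : gC s (i+4) j = 0 := by
  simp [gC]

theorem gC_big2 (s : ℝ) (i j : ℕ) : gC s i (j+4) = 0 := by
  rw [gC_symm, gC_big]

theorem gC_psd (s : ℝ) (hs : s ^ 2 = 4) (m : ℕ) :
    (Matrix.of fun i j : Fin (m+4) => gC s i.val j.val).PosSemidef := by
  refine Matrix.PosSemidef.of_dotProduct_mulVec_nonneg ?_ ?_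
  · ext i j
    simp [gC_symm s j.val i.val]
  · intro x
    have key : star x ⬝ᵥ ((Matrix.of fun i j : Fin (m+4) => gC s i.val j.val) *ᵥ x)
      = 3 * (x 0 ^ 2 + x 1 ^ 2 + x 2 ^ 2 + x 3 ^ 2)
        + 2 * s * (x 0 * x 1 + x 1 * x 2 + x 2 * x 3 - x 3 * x 0) := by
      have h2 : (2 : Fin (m+4)) = Fin.succ (Fin.succ 0) := rfl
      have h3 : (3 : Fin (m+4)) = Fin.succ (Fin.succ (Fin.succ 0)) := rfl
      have h1 : (1 : Fin (m+4)) = Fin.succ 0 := rfl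
      rw [h1, h2, h3]
      simp only [dotProduct, mulVec, Fin.sum_univ_succ, Matrix.of_apply, Fin.val_succ, Fin.val_zero,
        gC_big, gC_big2, zero_add, add_assoc, Nat.reduceAdd, zero_mul, Finset.sum_const_zero]
      simp [gC]
      ring
    rw [key]
    nlinarith [sq_nonneg (3 * x 1 + s * (x 0 + x 2)), sq_nonneg (3 * x 3 + s * (x 2 - x 0)),
      sq_nonneg (x 0), sq_nonneg (x 2)]

theorem gC_diag (i j : ℕ) : 2 * (if i = j then gC 2 i i else 0) - gC 2 i j = gC (-2) i j := by
  split
  · subst i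
    rcases j with _ | _ | _ | _ | j
    · norm_num [gC]
    · norm_num [gC]
    · norm_num [gC]
    · norm_num [gC]
    · simp [gC_big]
  · unfold gC
    split <;> simp_all

theorem Q_nonneg (m : ℕ) (x : Fin (m+4) → ℝ) (hx : sparsity x ≤ 2) :
    0 ≤ x 0 ^ 2 + x 1 ^ 2 + x 2 ^ 2 + x 3 ^ 2
        - 2 * (x 0 * x 1 + x 1 * x 2 + x 2 * x 3 - x 3 * x 0) := by
  have hd : (0 : Fin (m+4)) ≠ 1 ∧ (0 : Fin (m+4)) ≠ 2 ∧ (0 : Fin (m+4)) ≠ 3 ∧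
      (1 : Fin (m+4)) ≠ 2 ∧ (1 : Fin (m+4)) ≠ 3 ∧ (2 : Fin (m+4)) ≠ 3 := by
    have h2 : (2 : Fin (m+4)).val = 2 := rfl
    have h3 : (3 : Fin (m+4)).val = 3 := rfl
    have h1 : (1 : Fin (m+4)).val = 1 := rfl
    have h0 : (0 : Fin (m+4)).val = 0 := rfl
    simp only [ne_eq, Fin.ext_iff, h0, h1, h2, h3]
    omega
  obtain ⟨h01, h02, h03, h12, h13, h23⟩ := hd
  have tri : ∀ a b c : Fin (m+4), a ≠ b → a ≠ c → b ≠ c → x a = 0 ∨ x b = 0 ∨ x c = 0 := by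
    intro a b c hab hac hbc
    by_contra! h
    have hsub : ({a, b, c} : Finset (Fin (m+4))) ⊆ Finset.univ.filter fun i => x i ≠ 0 := by
      intro i hi
      simp only [Finset.mem_insert, Finset.mem_singleton] at hi
      rcases hi with rfl | rfl | rfl <;> simp [h]
    have := Finset.card_le_card hsub
    rw [Finset.card_eq_three.mpr ⟨a, b, c, hab, hac, hbc, rfl⟩] at this
    unfold sparsity at hx
    omega
  have t1 := tri 0 1 2 h01 h02 h12
  have t2 := tri 0 1 3 h01 h03 h13
  have t3 := tri 0 2 3 h02 h03 h23
  have t4 := tri 1 2 3 h12 h13 h23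
  generalize x 0 = a at *
  generalize x 1 = b at *
  generalize x 2 = c at *
  generalize x 3 = d at *
  clear tri hx
  rcases t1 with h | h | h
  · rcases t4 with h4 | h4 | h4 <;> rw [h, h4] <;>
      nlinarith [sq_nonneg (b - c), sq_nonneg (c - d), sq_nonneg b, sq_nonneg c, sq_nonneg d]
  · rcases t3 with h4 | h4 | h4 <;> rw [h, h4] <;>
      nlinarith [sq_nonneg (c - d), sq_nonneg (a + d), sq_nonneg a, sq_nonneg c, sq_nonneg d]
  · rcases t2 with h4 | h4 | h4 <;> rw [h, h4] <;>
      nlinarith [sq_nonneg (a - b), sq_nonneg (a + d), sq_nonneg a, sq_nonneg b, sq_nonneg d]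

theorem convexHull_Q_ssubset_spartra (n : ℕ) (hn : 4 ≤ n) :
    ∃ X ∈ Spartra n 2, X ∉ convexHull ℝ (Qset n 2) := by
  obtain ⟨m, rfl⟩ := Nat.exists_eq_add_of_le' hn
  refine ⟨Matrix.of fun i j : Fin (m+4) => gC 2 i.val j.val, ⟨?_, gC_psd 2 (by norm_num) m⟩, ?_⟩
  · convert gC_psd (-2) (by norm_num) m using 1
    ext i j
    have := gC_diag i.val j.val
    simpa [Matrix.diagonal_apply, Fin.ext_iff] using this
  · intro hX
    let C : Set (Matrix (Fin (m+4)) (Fin (m+4)) ℝ) :=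
      {Y | 0 ≤ Y 0 0 + Y 1 1 + Y 2 2 + Y 3 3 - 2 * (Y 0 1 + Y 1 2 + Y 2 3 - Y 3 0)}
    have hC : Convex ℝ C := by
      intro Y hY Z hZ a b ha hb _
      simp only [C, Set.mem_setOf_eq, Matrix.add_apply, Matrix.smul_apply, smul_eq_mul] at *
      nlinarith [mul_nonneg ha hY, mul_nonneg hb hZ]
    have hQ : Qset (m+4) 2 ⊆ C := by
      rintro _ ⟨x, hx, rfl⟩
      have := Q_nonneg m x hx
      simp only [C, Set.mem_setOf_eq, Matrix.vecMulVec_apply]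
      nlinarith [this]
    have := convexHull_min hQ hC hX
    have h2 : (2 : Fin (m+4)).val = 2 := rfl
    have h3 : (3 : Fin (m+4)).val = 3 := rfl
    have h1 : (1 : Fin (m+4)).val = 1 := rfl
    have h0 : (0 : Fin (m+4)).val = 0 := rfl
    simp only [C, Set.mem_setOf_eq, Matrix.of_apply, h0, h1, h2, h3, gC] at this
    norm_num at this
end

section
/- The cone S^z_{n,k} is contained in the cone S^{ℓ₁}_{n,k}: every X ∈ S^z_{n,k} satisfies ‖X‖₁ ≤ k·tr(X). -/
open Matrix Finset

/-- The cone `S^z_{n,k}` from Li–Xie-type relaxations. -/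
def Sz (n k : ℕ) : Set (Matrix (Fin n) (Fin n) ℝ) :=
  {X | X.PosSemidef ∧ ∃ z : Fin n → ℝ,
    (∀ i, (∑ j, (X i j) ^ 2) ≤ X i i * z i) ∧
    (∀ i, (∑ j, |X i j|) ^ 2 ≤ (k : ℝ) * (X i i * z i)) ∧
    (∀ i, 0 ≤ z i ∧ z i ≤ X.trace) ∧
    (∑ i, z i) = (k : ℝ) * X.trace}

/-- The `ℓ₁` cone: PSD matrices with `‖X‖₁ ≤ k · tr X`. -/
def Sone (n k : ℕ) : Set (Matrix (Fin n) (Fin n) ℝ) :=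
  {X | (∑ i, ∑ j, |X i j|) ≤ (k : ℝ) * X.trace ∧ X.PosSemidef}

theorem Sz_subset_Sone (n k : ℕ) (hk : 1 ≤ k) : Sz n k ⊆ Sone n k := by
  rintro X ⟨hX, z, -, h1, h2, h3⟩
  refine ⟨?_, hX⟩
  have key : ∀ i, (∑ j, |X i j|) ≤ ((k : ℝ) * X i i + z i) / 2 := by
    intro i
    have hd : 0 ≤ X i i := hX.diag_nonneg
    have hz := (h2 i).1
    have hk0 : (0 : ℝ) ≤ k := Nat.cast_nonneg k
    apply abs_le_of_sq_le_sq' _ (by positivity) |>.2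
    nlinarith [h1 i, sq_nonneg ((k : ℝ) * X i i - z i)]
  calc (∑ i, ∑ j, |X i j|) ≤ ∑ i, ((k : ℝ) * X i i + z i) / 2 :=
        Finset.sum_le_sum fun i _ => key i
    _ = (k : ℝ) * X.trace := by
        rw [← Finset.sum_div, Finset.sum_add_distrib, h3, ← Finset.mul_sum]
        simp only [Matrix.trace, Matrix.diag_apply]
        ring
end

section
/- Let 2k < n and let x ∈ ℝⁿ with ‖x‖₂ = 1, ‖x‖₀ = k, and not all of the nonzero coordinates of x identical. Then for every w ∈ ℝⁿ with ‖w‖₂ = 1 and ‖w‖₀ = n, and for every ε > 0, the matrix x xᵀ + ε w wᵀ does not belong to the k-spartrahedron S_{n,k}. -/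
open Matrix Finset

theorem perturbed_not_mem_spartra (n k : ℕ) (hk : 1 ≤ k) (hkn : 2 * k < n)
    (x : Fin n → ℝ) (hxnorm : ∑ i, (x i) ^ 2 = 1) (hxsupp : sparsity x = k)
    (hxne : ∃ i j, x i ≠ 0 ∧ x j ≠ 0 ∧ x i ≠ x j)
    (w : Fin n → ℝ) (hwnorm : ∑ i, (w i) ^ 2 = 1) (hwsupp : sparsity w = n)
    (ε : ℝ) (hε : 0 < ε) :
    Matrix.vecMulVec x x + ε • Matrix.vecMulVec w w ∉ Spartra n k := by
  rintro ⟨h, -⟩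
  have hw : ∀ i, w i ≠ 0 := by
    intro i hi
    have h1 : (Finset.univ.filter fun i => w i ≠ 0) = Finset.univ := by
      apply Finset.eq_univ_of_card
      simpa [sparsity] using hwsupp
    have h2 : i ∈ (Finset.univ.filter fun i => w i ≠ 0) := by rw [h1]; simp
    exact (Finset.mem_filter.mp h2).2 hi
  have hm : (Finset.univ.filter fun i => x i = 0).card + k = n := by
    have := Finset.card_filter_add_card_filter_not (s := (Finset.univ : Finset (Fin n))) (fun i => x i = 0)
    simp only [Finset.card_univ, Fintype.card_fin] at this
    rw [← hxsupp]
    exact this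
  set m := (Finset.univ.filter fun i => x i = 0).card with hmdef
  let v : Fin n → ℝ := fun i => if x i = 0 then (w i)⁻¹ else 0
  have hxv : x ⬝ᵥ v = 0 := by
    apply Finset.sum_eq_zero
    intro i _
    by_cases hx : x i = 0 <;> simp [v, hx]
  have hwv : w ⬝ᵥ v = m := by
    have : ∀ i, w i * v i = if x i = 0 then 1 else 0 := by
      intro i
      by_cases hx : x i = 0 <;> simp [v, hx, hw i]
    simp only [dotProduct, this, hmdef, Finset.sum_boole]
  have hd : v ⬝ᵥ ((Matrix.diagonal fun i => (Matrix.vecMulVec x x + ε • Matrix.vecMulVec w w) i i) *ᵥ v) = ε * m := by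
    have : ∀ i, v i * ((x i * x i + ε * (w i * w i)) * v i) = ε * if x i = 0 then 1 else 0 := by
      intro i
      have := hw i
      by_cases hx : x i = 0
      · simp [v, hx]; field_simp
      · simp [v, hx]
    simp only [dotProduct, Matrix.mulVec_diagonal, Matrix.add_apply, Matrix.smul_apply,
      Matrix.vecMulVec_apply, smul_eq_mul, this, ← Finset.mul_sum, hmdef, Finset.sum_boole]
  have hq := h.dotProduct_mulVec_nonneg v
  rw [star_trivial, Matrix.sub_mulVec, dotProduct_sub, Matrix.smul_mulVec, dotProduct_smul, hd,
    Matrix.add_mulVec, Matrix.smul_mulVec, Matrix.vecMulVec_mulVec, Matrix.vecMulVec_mulVec,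
    hxv, hwv] at hq
  simp only [dotProduct_add, dotProduct_smul, dotProduct_comm v w, hwv, MulOpposite.op_zero,
    zero_smul, dotProduct_zero, zero_add, smul_eq_mul, op_smul_eq_mul, op_smul_eq_smul] at hq
  have h3 : (k : ℝ) < m := by exact_mod_cast (by omega : k < m)
  have h4 : (0 : ℝ) ≤ k := by positivity
  have h5 : 0 < ε * m * (m - k) := by
    apply mul_pos (mul_pos hε (by linarith)); linarith
  nlinarith
end

section
/- Let C ∈ ℝ^{n×n} be a symmetric conference matrix, i.e., C is symmetric with zero diagonal, all off-diagonal entries equal to ±1, and CᵀC = (n−1)·Iₙ. If 2 ≤ k < √(n−1) + 1, then the matrix X := √(n−1)·Iₙ + C belongs to S_{n,k} but not to S^{ℓ₁}_{n,k}; in particular S_{n,k} is not contained in S^{ℓ₁}_{n,k}. -/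
open Matrix Finset

lemma conf_psd_aux {n : ℕ} (s : ℝ) (hs : 0 < s) (C : Matrix (Fin n) (Fin n) ℝ)
    (hC : Cᵀ = C) (hCC : C * C = (s * s) • (1 : Matrix (Fin n) (Fin n) ℝ)) :
    (s • (1 : Matrix (Fin n) (Fin n) ℝ) + C).PosSemidef := by
  have h := (Matrix.posSemidef_conjTranspose_mul_self
    (s • (1 : Matrix (Fin n) (Fin n) ℝ) + C)).smul (show (0 : ℝ) ≤ (2 * s)⁻¹ by positivity)
  convert h using 1
  have h1 : (s • (1 : Matrix (Fin n) (Fin n) ℝ) + C)ᴴ = s • (1 : Matrix (Fin n) (Fin n) ℝ) + C := by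
    rw [Matrix.conjTranspose_eq_transpose_of_trivial]
    simp [hC]
  rw [h1, eq_inv_smul_iff₀ (by positivity)]
  simp only [Matrix.add_mul, Matrix.mul_add, hCC, Matrix.smul_mul, Matrix.mul_smul, one_mul, mul_one]
  module

theorem spartra_not_subset_Sone (n k : ℕ) (C : Matrix (Fin n) (Fin n) ℝ)
    (hCsymm : C.IsSymm) (hCdiag : ∀ i, C i i = 0)
    (hCoff : ∀ i j, i ≠ j → C i j = 1 ∨ C i j = -1)
    (hCconf : Cᵀ * C = ((n : ℝ) - 1) • (1 : Matrix (Fin n) (Fin n) ℝ))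
    (hk2 : 2 ≤ k) (hk : (k : ℝ) < Real.sqrt ((n : ℝ) - 1) + 1) :
    (Real.sqrt ((n : ℝ) - 1) • (1 : Matrix (Fin n) (Fin n) ℝ) + C ∈ Spartra n k) ∧
    (Real.sqrt ((n : ℝ) - 1) • (1 : Matrix (Fin n) (Fin n) ℝ) + C ∉ Sone n k) ∧
    ¬ Spartra n k ⊆ Sone n k := by
  set s := Real.sqrt ((n : ℝ) - 1) with hsdef
  have hk2' : (2 : ℝ) ≤ k := by exact_mod_cast hk2
  have hs : 0 < s := by linarith
  have hn1 : 0 < (n : ℝ) - 1 := Real.sqrt_pos.mp hs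
  have hss : s * s = (n : ℝ) - 1 := Real.mul_self_sqrt hn1.le
  have hCC : C * C = (s * s) • (1 : Matrix (Fin n) (Fin n) ℝ) := by
    rw [hss, ← hCconf, hCsymm.eq]
  have hX : (s • (1 : Matrix (Fin n) (Fin n) ℝ) + C).PosSemidef :=
    conf_psd_aux s hs C hCsymm.eq hCC
  have hY : (s • (1 : Matrix (Fin n) (Fin n) ℝ) + -C).PosSemidef :=
    conf_psd_aux s hs (-C) (by rw [Matrix.transpose_neg, hCsymm.eq]) (by rw [neg_mul_neg, hCC])
  have hmem : s • (1 : Matrix (Fin n) (Fin n) ℝ) + C ∈ Spartra n k := by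
    refine ⟨?_, hX⟩
    have h1 : (Matrix.PosSemidef ((((k : ℝ) - 2) * s) • (1 : Matrix (Fin n) (Fin n) ℝ))) :=
      Matrix.PosSemidef.one.smul (mul_nonneg (by linarith) hs.le)
    convert h1.add hY using 1
    have hd : Matrix.diagonal (fun i => (s • (1 : Matrix (Fin n) (Fin n) ℝ) + C) i i)
        = s • (1 : Matrix (Fin n) (Fin n) ℝ) := by
      simp [hCdiag, Matrix.smul_one_eq_diagonal]
    rw [hd]
    module
  have hnot : s • (1 : Matrix (Fin n) (Fin n) ℝ) + C ∉ Sone n k := by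
    rintro ⟨h, -⟩
    have hent : ∀ i j, |(s • (1 : Matrix (Fin n) (Fin n) ℝ) + C) i j|
        = 1 + if i = j then s - 1 else 0 := by
      intro i j
      by_cases hij : i = j
      · subst hij
        simp [hCdiag, abs_of_pos hs]
      · rcases hCoff i j hij with h | h <;> simp [hij, h]
    have htr : (s • (1 : Matrix (Fin n) (Fin n) ℝ) + C).trace = n * s := by
      simp [Matrix.trace, hCdiag]
    simp only [hent, htr, Finset.sum_add_distrib, Finset.sum_ite_eq, Finset.mem_univ, if_true,
      Finset.sum_const, Finset.card_univ, Fintype.card_fin, nsmul_eq_mul] at h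
    have hpos : 0 < (n : ℝ) * s := mul_pos (by linarith) hs
    have h2 := mul_lt_mul_of_pos_left hk hpos
    have h3 : (n : ℝ) * (s * s) = n * (n - 1) := by rw [hss]
    nlinarith
  exact ⟨hmem, hnot, fun hsub => hnot (hsub hmem)⟩
end

section
/- The set of extreme rays of the convex cone conv(Q_{n,k}) equals Q_{n,k} \ {0}; that is, a nonzero matrix X is an extreme ray of conv(Q_{n,k}) if and only if X = x xᵀ for some x ∈ ℝⁿ with ‖x‖₀ ≤ k. -/
open Matrix Finset

/-- `X` spans an extreme ray of the convex cone `K`: `X` is a nonzero element of `K`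
and whenever `X = X₁ + X₂` with `X₁, X₂ ∈ K`, both summands are
nonnegative multiples of `X`. -/
def IsExtremeRay {E : Type*} [AddCommMonoid E] [Module ℝ E] (K : Set E) (X : E) : Prop :=
  X ≠ 0 ∧ X ∈ K ∧ ∀ X₁ X₂, X₁ ∈ K → X₂ ∈ K → X = X₁ + X₂ →
    (∃ c₁ : ℝ, 0 ≤ c₁ ∧ X₁ = c₁ • X) ∧ (∃ c₂ : ℝ, 0 ≤ c₂ ∧ X₂ = c₂ • X)

lemma aux_smul {n k : ℕ} {X : Matrix (Fin n) (Fin n) ℝ} (hX : X ∈ Qset n k) {c : ℝ}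
    (hc : 0 ≤ c) : c • X ∈ Qset n k := by
  obtain ⟨x, hx, rfl⟩ := hX
  refine ⟨fun i => Real.sqrt c * x i, le_trans ?_ hx, ?_⟩
  · apply Finset.card_le_card
    intro i hi
    simp only [Finset.mem_filter, Finset.mem_univ, true_and] at hi ⊢
    exact right_ne_zero_of_mul hi
  · ext i j
    simp only [Matrix.smul_apply, Matrix.vecMulVec_apply, smul_eq_mul]
    have := Real.mul_self_sqrt hc
    linear_combination (-(x i * x j)) * this

lemma aux_psd {n k : ℕ} {X : Matrix (Fin n) (Fin n) ℝ} (hX : X ∈ convexHull ℝ (Qset n k)) :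
    X.PosSemidef := by
  have hconv : Convex ℝ {X : Matrix (Fin n) (Fin n) ℝ | X.PosSemidef} := by
    intro A hA B hB a b ha hb _
    exact (Matrix.PosSemidef.smul hA ha).add (Matrix.PosSemidef.smul hB hb)
  refine convexHull_min ?_ hconv hX
  rintro _ ⟨x, _, rfl⟩
  simpa using Matrix.posSemidef_vecMulVec_self_star x

lemma aux_rank {n : ℕ} {x : Fin n → ℝ} {p : Fin n} (hp : x p ≠ 0)
    {A B : Matrix (Fin n) (Fin n) ℝ} (hA : A.PosSemidef) (hB : B.PosSemidef)
    (h : Matrix.vecMulVec x x = A + B) :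
    ∃ c : ℝ, 0 ≤ c ∧ A = c • Matrix.vecMulVec x x := by
  have key : ∀ i j, x p * A i j = x j * A i p := by
    intro i j
    set v : Fin n → ℝ := Pi.single j (x p) - Pi.single p (x j) with hv
    have h0 : v ⬝ᵥ (Matrix.vecMulVec x x *ᵥ v) = 0 := by
      have : Matrix.vecMulVec x x *ᵥ v = 0 := by
        ext a
        simp [hv, Matrix.mulVec_sub, Matrix.vecMulVec_apply]
        ring
      rw [this]; simp
    rw [h, Matrix.add_mulVec, dotProduct_add] at h0
    have h1 := hA.dotProduct_mulVec_nonneg v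
    have h2 := hB.dotProduct_mulVec_nonneg v
    have h3 := (hA.dotProduct_mulVec_zero_iff v).1 (by
      simp only [star_trivial] at *; linarith)
    have h4 := congrFun h3 i
    simp [hv, Matrix.mulVec_sub] at h4
    linarith
  have hs : ∀ i j, A i j = A j i := fun i j => by
    have := hA.isHermitian.apply i j
    simpa using this.symm
  have hd : 0 ≤ A p p := hA.diag_nonneg
  refine ⟨A p p / (x p * x p), div_nonneg hd (mul_self_nonneg _), ?_⟩
  ext i j
  simp only [Matrix.smul_apply, Matrix.vecMulVec_apply, smul_eq_mul]
  have e1 := key i j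
  have e2 := key p i
  rw [hs p i] at e2
  field_simp
  linear_combination x p * e1 + x j * e2

theorem extremeRays_convexHull_Q (n k : ℕ) (hk : 1 ≤ k)
    (X : Matrix (Fin n) (Fin n) ℝ) :
    IsExtremeRay (convexHull ℝ (Qset n k)) X ↔ X ∈ Qset n k \ {0} := by
  classical
  constructor
  · rintro ⟨hX0, hX, hext⟩
    refine ⟨?_, hX0⟩
    obtain ⟨ι, _, w, z, hw, hw1, hz, hsum⟩ := mem_convexHull_iff_exists_fintype.1 hX
    obtain ⟨i, hi⟩ : ∃ i, w i • z i ≠ 0 := by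
      by_contra! hcon
      exact hX0 (by rw [← hsum]; exact Finset.sum_eq_zero fun i _ => hcon i)
    have hQ0 : (0 : Matrix (Fin n) (Fin n) ℝ) ∈ Qset n k := by
      simpa using aux_smul (hz i) (le_refl 0)
    have hwz : w i • z i ∈ Qset n k := aux_smul (hz i) (hw i)
    have hrest : ∑ j, w j • (Function.update z i 0) j ∈ convexHull ℝ (Qset n k) := by
      refine mem_convexHull_iff_exists_fintype.2
        ⟨ι, inferInstance, w, Function.update z i 0, hw, hw1, ?_, rfl⟩
      intro j
      by_cases hj : j = i
      · subst hj; simpa using hQ0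
      · simpa [hj] using hz j
    have hXs : X = w i • z i + ∑ j, w j • (Function.update z i 0) j := by
      rw [← hsum, ← Finset.add_sum_erase _ _ (Finset.mem_univ i),
        ← Finset.add_sum_erase (a := i) _ (fun j => w j • (Function.update z i 0) j)
          (Finset.mem_univ i)]
      simp only [Function.update_self, smul_zero, zero_add]
      congr 1
      refine Finset.sum_congr rfl fun j hj => ?_
      rw [Function.update_of_ne (Finset.ne_of_mem_erase hj)]
    obtain ⟨⟨c, hc, hcX⟩, -⟩ := hext _ _ (subset_convexHull ℝ _ hwz) hrest hXs
    have hc0 : c ≠ 0 := by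
      rintro rfl
      exact hi (by rw [hcX, zero_smul])
    have : X = c⁻¹ • (w i • z i) := by rw [hcX, smul_smul, inv_mul_cancel₀ hc0, one_smul]
    rw [this]
    exact aux_smul hwz (inv_nonneg.2 hc)
  · rintro ⟨hX, hX0⟩
    refine ⟨hX0, subset_convexHull ℝ _ hX, ?_⟩
    intro A B hA hB h
    obtain ⟨x, hx, rfl⟩ := hX
    obtain ⟨p, hp⟩ : ∃ p, x p ≠ 0 := by
      by_contra! hcon
      apply hX0
      ext i j
      simp [Matrix.vecMulVec_apply, hcon]
    exact ⟨aux_rank hp (aux_psd hA) (aux_psd hB) h,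
      aux_rank hp (aux_psd hB) (aux_psd hA) (by rw [h, add_comm])⟩
end

section
/- The rank-one extreme rays of the k-spartrahedron are exactly the nonzero elements of Q_{n,k}: {X ∈ S_{n,k} : X is an extreme ray of S_{n,k} and rank(X) = 1} = Q_{n,k} \ {0}. -/
open Matrix Finset

theorem aux_form {n : ℕ} (k : ℝ) (x v : Fin n → ℝ) :
    v ⬝ᵥ ((k • Matrix.diagonal (fun i => vecMulVec x x i i) - vecMulVec x x) *ᵥ v)
      = k * ∑ i, (x i * v i) ^ 2 - (∑ i, x i * v i) ^ 2 := by
  rw [sub_mulVec, dotProduct_sub, smul_mulVec, dotProduct_smul]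
  congr 1
  · simp only [dotProduct, mulVec_diagonal, vecMulVec_apply, smul_eq_mul]
    congr 1
    exact Finset.sum_congr rfl fun i _ => by ring
  · rw [sq, Finset.sum_mul_sum]
    simp only [dotProduct, mulVec, vecMulVec_apply, Finset.mul_sum]
    exact Finset.sum_congr rfl fun i _ => Finset.sum_congr rfl fun j _ => by ring

theorem aux_herm {n : ℕ} (k : ℝ) (x : Fin n → ℝ) :
    (k • Matrix.diagonal (fun i => vecMulVec x x i i) - vecMulVec x x).IsHermitian := by
  ext i j
  by_cases h : i = j
  · subst h; simp
  · simp [Matrix.diagonal_apply_ne _ h, Matrix.diagonal_apply_ne _ (Ne.symm h), vecMulVec_apply,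
      mul_comm]

theorem aux_psd_s10 {n : ℕ} (x : Fin n → ℝ) : (vecMulVec x x).PosSemidef := by
  simpa using posSemidef_vecMulVec_self_star x

theorem aux_mem {n k : ℕ} (x : Fin n → ℝ) (hx : sparsity x ≤ k) :
    vecMulVec x x ∈ Spartra n k := by
  refine ⟨PosSemidef.of_dotProduct_mulVec_nonneg (aux_herm _ x) fun v => ?_, aux_psd_s10 x⟩
  rw [star_trivial, aux_form]
  have h1 : ∑ i, x i * v i = ∑ i ∈ Finset.univ.filter (fun i => x i ≠ 0), x i * v i := by
    rw [Finset.sum_filter]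
    refine Finset.sum_congr rfl fun i _ => ?_
    by_cases h : x i = 0 <;> simp [h]
  have h2 : ∑ i, (x i * v i) ^ 2
      = ∑ i ∈ Finset.univ.filter (fun i => x i ≠ 0), (x i * v i) ^ 2 := by
    rw [Finset.sum_filter]
    refine Finset.sum_congr rfl fun i _ => ?_
    by_cases h : x i = 0 <;> simp [h]
  have h3 := sq_sum_le_card_mul_sum_sq (s := Finset.univ.filter (fun i => x i ≠ 0))
    (f := fun i => x i * v i)
  rw [← h1, ← h2] at h3
  have h4 : (sparsity x : ℝ) ≤ k := by exact_mod_cast hx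
  have h5 : 0 ≤ ∑ i, (x i * v i) ^ 2 := Finset.sum_nonneg fun i _ => sq_nonneg _
  have h6 := mul_le_mul_of_nonneg_right h4 h5
  unfold sparsity at h6
  linarith

theorem aux_sparse {n k : ℕ} (x : Fin n → ℝ) (h : vecMulVec x x ∈ Spartra n k) :
    sparsity x ≤ k := by
  have h1 := h.1.dotProduct_mulVec_nonneg (fun i => (x i)⁻¹)
  rw [star_trivial, aux_form] at h1
  have h2 : ∀ i, x i * (x i)⁻¹ = if x i ≠ 0 then 1 else 0 := fun i => by
    by_cases h : x i = 0 <;> simp [h]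
  have h3 : ∑ i, x i * (x i)⁻¹ = (sparsity x : ℝ) := by
    simp only [h2, sparsity, Finset.sum_boole]
  have h4 : ∑ i, (x i * (x i)⁻¹) ^ 2 = (sparsity x : ℝ) := by
    rw [← h3]
    refine Finset.sum_congr rfl fun i _ => ?_
    by_cases h : x i = 0 <;> simp [h]
  rw [h3, h4] at h1
  by_contra hc
  push Not at hc
  have h5 : (k : ℝ) < sparsity x := by exact_mod_cast hc
  have h6 : (0 : ℝ) ≤ k := Nat.cast_nonneg k
  nlinarith

theorem aux_ext {n : ℕ} (x : Fin n → ℝ) (p : Fin n) (hp : x p ≠ 0)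
    (A B : Matrix (Fin n) (Fin n) ℝ) (hA : A.PosSemidef) (hB : B.PosSemidef)
    (h : vecMulVec x x = A + B) : ∃ c : ℝ, 0 ≤ c ∧ A = c • vecMulVec x x := by
  have key : ∀ i j, x p * A j i = x i * A j p := by
    intro i j
    set v : Fin n → ℝ := x p • Pi.single i 1 - x i • Pi.single p 1 with hv
    have hxv : x ⬝ᵥ v = 0 := by
      simp [hv, dotProduct_sub]; ring
    have h0 : v ⬝ᵥ (A *ᵥ v) + v ⬝ᵥ (B *ᵥ v) = 0 := by
      rw [← dotProduct_add, ← add_mulVec, ← h, vecMulVec_mulVec, hxv]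
      simp
    have h1 := hA.dotProduct_mulVec_nonneg v
    have h2 := hB.dotProduct_mulVec_nonneg v
    rw [star_trivial] at h1 h2
    have h3 : star v ⬝ᵥ (A *ᵥ v) = 0 := by rw [star_trivial]; linarith
    have h4 := congrFun ((hA.dotProduct_mulVec_zero_iff v).1 h3) j
    simp [hv, mulVec_sub, mulVec_smul] at h4
    linarith
  have symm : ∀ i j, A i j = A j i := fun i j => by
    simpa using hA.isHermitian.apply j i
  refine ⟨A p p / x p ^ 2, div_nonneg hA.diag_nonneg (sq_nonneg _), ?_⟩
  ext i j
  have e1 := key j i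
  have e2 := key i p
  rw [symm p i] at e2
  simp only [Matrix.smul_apply, vecMulVec_apply, smul_eq_mul]
  field_simp
  linear_combination x p * e1 + x j * e2

theorem aux_rank_s10 {n : ℕ} (X : Matrix (Fin n) (Fin n) ℝ) (hX : X.PosSemidef) (hr : X.rank = 1)
    (h0 : X ≠ 0) : ∃ x : Fin n → ℝ, X = vecMulVec x x := by
  obtain ⟨u, w, huw⟩ : ∃ u w : Fin n → ℝ, ∀ i j, X i j = u i * w j := by
    unfold Matrix.rank at hr
    obtain ⟨u, -, hu⟩ := finrank_eq_one_iff'.1 hr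
    have : ∀ j, ∃ c : ℝ, ∀ i, X i j = u.1 i * c := by
      intro j
      obtain ⟨c, hc⟩ := hu ⟨X *ᵥ Pi.single j 1, ⟨Pi.single j 1, rfl⟩⟩
      refine ⟨c, fun i => ?_⟩
      have := congrFun (congrArg Subtype.val hc) i
      simp at this
      rw [← this, mul_comm]
    choose w hw using this
    exact ⟨u.1, w, fun i j => hw j i⟩
  have symm : ∀ i j, u i * w j = u j * w i := fun i j => by
    rw [← huw, ← huw]; simpa using hX.isHermitian.apply j i
  obtain ⟨p, hp⟩ : ∃ p, X p p ≠ 0 := by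
    by_contra hc
    push Not at hc
    apply h0
    ext i j
    have a := hc i
    have b := symm i j
    rw [huw] at a
    rw [huw, Matrix.zero_apply]
    rcases mul_eq_zero.1 a with a | a
    · simp [a]
    · rw [b, a, mul_zero]
  have hpos : 0 < X p p := lt_of_le_of_ne hX.diag_nonneg (Ne.symm hp)
  have hs := Real.sq_sqrt hpos.le
  have hs0 := (Real.sqrt_pos.2 hpos).ne'
  refine ⟨fun i => X i p / Real.sqrt (X p p), ?_⟩
  ext i j
  rw [vecMulVec_apply, div_mul_div_comm, ← sq, hs, eq_div_iff hp, huw, huw, huw, huw]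
  linear_combination u i * w p * symm p j

theorem rank_one_extremeRays_spartra (n k : ℕ) (hk : 1 ≤ k) :
    {X : Matrix (Fin n) (Fin n) ℝ | IsExtremeRay (Spartra n k) X ∧ X.rank = 1}
      = Qset n k \ {0} := by
  ext X
  constructor
  · rintro ⟨⟨h0, hm, -⟩, hr⟩
    obtain ⟨x, rfl⟩ := aux_rank_s10 X hm.2 hr h0
    exact ⟨⟨x, aux_sparse x hm, rfl⟩, h0⟩
  · rintro ⟨⟨x, hx, rfl⟩, h0⟩
    have h0' : vecMulVec x x ≠ 0 := h0
    obtain ⟨p, hp⟩ : ∃ p, x p ≠ 0 := by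
      by_contra hc
      push Not at hc
      apply h0'
      ext i j
      simp [vecMulVec_apply, hc]
    refine ⟨⟨h0', aux_mem x hx, fun A B hA hB h => ⟨aux_ext x p hp A B hA.2 hB.2 h,
      aux_ext x p hp B A hB.2 hA.2 (by rw [h, add_comm])⟩⟩, ?_⟩
    have h1 := rank_vecMulVec_le x x
    have h2 : (vecMulVec x x).rank ≠ 0 := by
      intro h
      unfold Matrix.rank at h
      have h3 := LinearMap.range_eq_bot.1 (Submodule.finrank_eq_zero.1 h)
      have h4 := congrFun (LinearMap.congr_fun h3 (Pi.single p 1)) p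
      simp [vecMulVec_apply, hp] at h4
    omega
end

section
/- Let n ≥ 4 and 2 ≤ k < n. Let X = u₁u₁ᵀ + u₂u₂ᵀ where ‖u₁‖₂ = ‖u₂‖₂ = 1, ⟨u₁,u₂⟩ = 0, and u₁, u₂ satisfy: (i) Σᵢ (u₁)ᵢ(u₂)ᵢ((u₁)ᵢ² + (u₂)ᵢ²) = 0; (ii) Σᵢ (u₁)ᵢ⁴ = Σᵢ (u₂)ᵢ⁴ < 1/k; (iii) Σᵢ ((u₁)ᵢ² + (u₂)ᵢ²)² = 2/k; and (iv) (u₁)ᵢ² + (u₂)ᵢ² = (u₁)ⱼ² + (u₂)ⱼ² for all i, j ∈ [n]. If X ∉ conv(Q_{n,k}), then X is an extreme ray of the k-spartrahedron S_{n,k}. -/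
open Matrix Finset

lemma aux_two (k a1 a2 b1 b2 : ℝ) (hk : 0 < k) (ha : k * (a1 ^ 2 + a2 ^ 2) = 1)
    (hb : k * (b1 ^ 2 + b2 ^ 2) = 1) (hab : a1 * b1 + a2 * b2 = 0) :
    k * (a1 ^ 2 + b1 ^ 2) = 1 ∧ k * (a2 ^ 2 + b2 ^ 2) = 1 ∧ a1 * a2 + b1 * b2 = 0 := by
  obtain ⟨t, ht⟩ : ∃ t, t = k * (a1 * b2 - a2 * b1) := ⟨_, rfl⟩
  have h1 : b2 = t * a1 := by
    rw [ht]; linear_combination (-b2) * ha + k * a2 * hab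
  have h2 : b1 = -(t * a2) := by
    rw [ht]; linear_combination (-b1) * ha + k * a1 * hab
  have h3 : t ^ 2 = 1 := by
    rw [h1, h2] at hb
    linear_combination hb - t ^ 2 * ha
  refine ⟨?_, ?_, ?_⟩
  · rw [h2]; linear_combination ha + k * a2 ^ 2 * h3
  · rw [h1]; linear_combination ha + k * a1 ^ 2 * h3
  · rw [h1, h2]; linear_combination (-a1 * a2) * h3

lemma aux_sparse_s11 {n k : ℕ} (hk : 0 < k) (v : Fin n → ℝ) (hs : ∑ i, v i ^ 2 = 1)
    (hv : ∀ i, v i ≠ 0 → v i ^ 2 = 1 / (k : ℝ)) : sparsity v ≤ k := by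
  have h : ∑ i, v i ^ 2 = (sparsity v : ℝ) * (1 / (k : ℝ)) := by
    rw [sparsity, ← nsmul_eq_mul, ← Finset.sum_const, Finset.sum_filter]
    refine Finset.sum_congr rfl fun i _ => ?_
    split_ifs with h
    · exact hv i h
    · simp only [ne_eq, not_not] at h
      simp [h]
  have hk' : (0 : ℝ) < k := by exact_mod_cast hk
  rw [hs] at h
  field_simp at h
  exact_mod_cast h.symm.le

/-- Vectors killed by a sum of PSD matrices are killed by the first summand. -/
lemma aux_ker {n : ℕ} {A B C : Matrix (Fin n) (Fin n) ℝ} (hA : A.PosSemidef) (hB : B.PosSemidef)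
    (Y : Matrix (Fin n) (Fin n) ℝ) (hC : C = A + B) (hY : C * Y = 0) : A * Y = 0 := by
  ext i j
  have h0 : C *ᵥ (fun l => Y l j) = 0 := by
    ext l
    simpa [Matrix.mul_apply, Matrix.mulVec, dotProduct] using congrFun (congrFun hY l) j
  have ha := hA.dotProduct_mulVec_nonneg (fun l => Y l j)
  have hb := hB.dotProduct_mulVec_nonneg (fun l => Y l j)
  have hab : star (fun l => Y l j) ⬝ᵥ (C *ᵥ (fun l => Y l j)) = 0 := by rw [h0]; simp
  rw [hC, Matrix.add_mulVec, dotProduct_add] at hab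
  have := (hA.dotProduct_mulVec_zero_iff (fun l => Y l j)).1 (by linarith)
  simpa [Matrix.mul_apply, Matrix.mulVec, dotProduct] using congrFun this i

lemma aux_main {n k : ℕ} (hk : 0 < k) (hn : 0 < n)
    (u₁ u₂ : Fin n → ℝ) (X : Matrix (Fin n) (Fin n) ℝ)
    (hXe : ∀ i j, X i j = u₁ i * u₁ j + u₂ i * u₂ j)
    (hXT : ∀ i j, X i j = X j i)
    (hXX : X * X = X) (hXd : ∀ i, X i i = 1 / (k : ℝ))
    (hXnot : X ∉ convexHull ℝ (Qset n k))
    (X₁ X₂ : Matrix (Fin n) (Fin n) ℝ) (h₁ : X₁ ∈ Spartra n k) (h₂ : X₂ ∈ Spartra n k)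
    (hs : X = X₁ + X₂) : ∃ c : ℝ, 0 ≤ c ∧ X₁ = c • X := by
  have hk' : (0 : ℝ) < k := by exact_mod_cast hk
  have e1 : X₁ * (1 - X) = 0 := aux_ker h₁.2 h₂.2 _ hs (by rw [mul_sub, hXX]; simp)
  have e2 : ((k : ℝ) • Matrix.diagonal (fun i => X₁ i i) - X₁) * X = 0 := by
    refine aux_ker h₁.1 h₂.1 X (C := 1 - X) ?_ (by rw [sub_mul, hXX]; simp)
    ext i j
    have hd := hXd i
    rw [hs] at hd ⊢
    simp only [Matrix.add_apply] at hd
    by_cases hij : i = j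
    · subst hij
      simp
      have : (k : ℝ) * (X₁ i i + X₂ i i) = 1 := by rw [hd]; field_simp
      linarith
    · simp [hij]; ring
  have e3 : X₁ = X₁ * X := by
    rw [mul_sub, mul_one] at e1
    exact sub_eq_zero.1 e1
  have e4 : ∀ i j, X₁ i j = k * X₁ i i * X i j := by
    intro i j
    rw [sub_mul, ← e3] at e2
    have := congrFun (congrFun e2 i) j
    simp [Matrix.sub_apply, Matrix.diagonal_mul] at this
    linarith
  have hsym : ∀ i j, X₁ i j = X₁ j i := by
    intro i j
    have := h₁.2.1.apply i j
    simpa using this.symm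
  have e5 : ∀ i j, X₁ i i ≠ X₁ j j → X i j = 0 := by
    intro i j hne
    have := hsym i j
    rw [e4 i j, e4 j i, hXT j i] at this
    have h : (k : ℝ) * (X₁ i i - X₁ j j) * X i j = 0 := by linear_combination this
    simpa [hk'.ne', sub_eq_zero, hne] using h
  by_cases hall : ∀ i, X₁ i i = X₁ ⟨0, hn⟩ ⟨0, hn⟩
  · refine ⟨k * X₁ ⟨0, hn⟩ ⟨0, hn⟩, mul_nonneg hk'.le (h₁.2.diag_nonneg), ?_⟩
    ext i j
    rw [e4 i j, hall i]; simp
  · exfalso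
    push Not at hall
    obtain ⟨a, hab⟩ := hall
    obtain ⟨b, hb⟩ : ∃ b, b = (⟨0, hn⟩ : Fin n) := ⟨_, rfl⟩
    rw [← hb] at hab
    apply hXnot
    have hda : (k : ℝ) * (u₁ a ^ 2 + u₂ a ^ 2) = 1 := by
      have := hXd a
      rw [hXe] at this
      field_simp at this
      linarith
    have hdb : (k : ℝ) * (u₁ b ^ 2 + u₂ b ^ 2) = 1 := by
      have := hXd b
      rw [hXe] at this
      field_simp at this
      linarith
    have hd0 : u₁ a * u₁ b + u₂ a * u₂ b = 0 := by rw [← hXe]; exact e5 a b hab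
    obtain ⟨f1, f2, f3⟩ := aux_two k _ _ _ _ hk' hda hdb hd0
    have key : ∀ i j, k * (X i a * X j a + X i b * X j b) = X i j := by
      intro i j
      simp only [hXe]
      linear_combination (u₁ i * u₁ j) * f1 + (u₂ i * u₂ j) * f2 +
        (k * (u₁ i * u₂ j + u₂ i * u₁ j)) * f3
    have hprod : ∀ l, X l a = 0 ∨ X l b = 0 := by
      intro l
      by_cases h : X₁ l l = X₁ a a
      · right; apply e5; rw [h]; exact hab
      · left; exact e5 _ _ h
    have hsq : ∀ c, ∑ i, X i c ^ 2 = 1 / (k : ℝ) := by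
      intro c
      rw [← hXd c]
      conv_rhs => rw [← hXX]
      rw [Matrix.mul_apply]
      exact Finset.sum_congr rfl fun i _ => by rw [hXT c i]; ring
    have hss : Real.sqrt k ^ 2 = k := Real.sq_sqrt hk'.le
    have hssum : ∀ c, ∑ i, (Real.sqrt k * X i c) ^ 2 = 1 := by
      intro c
      simp only [mul_pow, hss, ← Finset.mul_sum, hsq]
      field_simp
    have sa : sparsity (fun l => Real.sqrt k * X l a) ≤ k := by
      refine aux_sparse_s11 hk _ (hssum a) fun i hi => ?_
      have h := (hprod i).resolve_left (fun h => hi (by simp [h]))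
      have := key i i
      rw [h, hXd] at this
      rw [mul_pow, hss, ← this]; ring
    have sb : sparsity (fun l => Real.sqrt k * X l b) ≤ k := by
      refine aux_sparse_s11 hk _ (hssum b) fun i hi => ?_
      have h := (hprod i).resolve_right (fun h => hi (by simp [h]))
      have := key i i
      rw [h, hXd] at this
      rw [mul_pow, hss, ← this]; ring
    have s2 : Real.sqrt 2 ^ 2 = 2 := Real.sq_sqrt (by norm_num)
    have hq : ∀ v : Fin n → ℝ, sparsity v ≤ k → (2 : ℝ) • Matrix.vecMulVec v v ∈ Qset n k := by
      intro v hv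
      refine ⟨fun i => Real.sqrt 2 * v i, ?_, ?_⟩
      · simpa [sparsity] using hv
      · ext i j
        simp only [Matrix.smul_apply, Matrix.vecMulVec_apply, smul_eq_mul]
        linear_combination (-(v i * v j)) * s2
    have hX' : X = (1 / 2 : ℝ) • ((2 : ℝ) • Matrix.vecMulVec (fun l => Real.sqrt k * X l a)
          (fun l => Real.sqrt k * X l a)) +
        (1 / 2 : ℝ) • ((2 : ℝ) • Matrix.vecMulVec (fun l => Real.sqrt k * X l b)
          (fun l => Real.sqrt k * X l b)) := by
      ext i j
      simp only [Matrix.add_apply, Matrix.smul_apply, Matrix.vecMulVec_apply, smul_eq_mul]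
      rw [← key i j]
      linear_combination (-(X i a * X j a + X i b * X j b)) * hss
    rw [hX']
    exact convex_convexHull ℝ _ (subset_convexHull ℝ _ (hq _ sa)) (subset_convexHull ℝ _ (hq _ sb))
      (by norm_num) (by norm_num) (by norm_num)

theorem rank_two_extreme_ray_spartra (n k : ℕ) (hn : 4 ≤ n) (hk2 : 2 ≤ k) (hkn : k < n)
    (u₁ u₂ : Fin n → ℝ)
    (hu₁ : ∑ i, (u₁ i) ^ 2 = 1) (hu₂ : ∑ i, (u₂ i) ^ 2 = 1)
    (horth : ∑ i, u₁ i * u₂ i = 0)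
    (hi : ∑ i, u₁ i * u₂ i * ((u₁ i) ^ 2 + (u₂ i) ^ 2) = 0)
    (hii : ∑ i, (u₁ i) ^ 4 = ∑ i, (u₂ i) ^ 4)
    (hii' : ∑ i, (u₁ i) ^ 4 < 1 / (k : ℝ))
    (hiii : ∑ i, ((u₁ i) ^ 2 + (u₂ i) ^ 2) ^ 2 = 2 / (k : ℝ))
    (hiv : ∀ i j, (u₁ i) ^ 2 + (u₂ i) ^ 2 = (u₁ j) ^ 2 + (u₂ j) ^ 2)
    (X : Matrix (Fin n) (Fin n) ℝ)
    (hX : X = Matrix.vecMulVec u₁ u₁ + Matrix.vecMulVec u₂ u₂)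
    (hXnot : X ∉ convexHull ℝ (Qset n k)) :
    IsExtremeRay (Spartra n k) X := by
  have hk0 : 0 < k := by omega
  have hn0 : 0 < n := by omega
  have hk' : (0 : ℝ) < k := by exact_mod_cast hk0
  have hXe : ∀ i j, X i j = u₁ i * u₁ j + u₂ i * u₂ j := by
    intro i j
    rw [hX]; simp [Matrix.vecMulVec_apply]
  have hXT : ∀ i j, X i j = X j i := by
    intro i j
    rw [hXe, hXe]; ring
  have hXX : X * X = X := by
    ext i j
    rw [Matrix.mul_apply]
    have : ∀ l, X i l * X l j = (u₁ i * u₁ j) * (u₁ l ^ 2) + (u₂ i * u₂ j) * (u₂ l ^ 2) +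
        (u₁ i * u₂ j + u₂ i * u₁ j) * (u₁ l * u₂ l) := by
      intro l
      rw [hXe, hXe]; ring
    simp only [this, Finset.sum_add_distrib, ← Finset.mul_sum, hu₁, hu₂, horth]
    rw [hXe]; ring
  have hXd : ∀ i, X i i = 1 / (k : ℝ) := by
    intro i
    have hsum : ∑ j, (u₁ j ^ 2 + u₂ j ^ 2) = 2 := by
      rw [Finset.sum_add_distrib, hu₁, hu₂]; norm_num
    have h3 : ∑ j, (u₁ j ^ 2 + u₂ j ^ 2) ^ 2 = (u₁ i ^ 2 + u₂ i ^ 2) * 2 := by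
      rw [← hsum, Finset.mul_sum]
      exact Finset.sum_congr rfl fun j _ => by rw [hiv j i]; ring
    rw [hiii] at h3
    rw [hXe]
    linear_combination (-1 / 2 : ℝ) * h3
  have hXH : Xᴴ = X := by
    ext i j
    simp [hXT j i]
  refine ⟨?_, ⟨?_, ?_⟩, ?_⟩
  · intro h0
    have := hXd ⟨0, hn0⟩
    rw [h0, Matrix.zero_apply] at this
    have hpos : 0 < 1 / (k : ℝ) := by positivity
    linarith
  · have : (k : ℝ) • Matrix.diagonal (fun i => X i i) - X = (1 - X)ᴴ * (1 - X) := by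
      rw [Matrix.conjTranspose_sub, hXH, Matrix.conjTranspose_one, mul_sub, sub_mul, sub_mul, hXX]
      have hd : (k : ℝ) • Matrix.diagonal (fun i => X i i) = 1 := by
        ext i j
        by_cases hij : i = j
        · subst hij; simp [hXd, hk'.ne']
        · simp [hij]
      rw [hd]; simp
    rw [this]
    exact Matrix.posSemidef_conjTranspose_mul_self _
  · have := Matrix.posSemidef_conjTranspose_mul_self X
    rwa [hXH, hXX] at this
  · intro X₁ X₂ h₁ h₂ hs
    exact ⟨aux_main hk0 hn0 u₁ u₂ X hXe hXT hXX hXd hXnot X₁ X₂ h₁ h₂ hs,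
      aux_main hk0 hn0 u₁ u₂ X hXe hXT hXX hXd hXnot X₂ X₁ h₂ h₁ (by rw [hs, add_comm])⟩
end

section
/- Let K ⊆ 𝕊ⁿ be a convex cone with Q_{n,k} ⊆ K ⊆ S_{n,k}, let C, A₁, …, A_m ∈ 𝕊ⁿ and b ∈ ℝ^m. If x xᵀ is an optimal solution of the relaxation min{tr(CX) : tr(AᵢX) = bᵢ for all i ∈ [m], X ∈ K}, then ‖x‖₀ ≤ k and x is an optimal solution of the sparse QCQP min{xᵀCx : ‖x‖₀ ≤ k, xᵀAᵢx = bᵢ for all i ∈ [m]}; in particular the two problems have the same optimal value. -/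
open Matrix Finset

theorem trace_mul_vecMulVec_aux {n : ℕ} (M : Matrix (Fin n) (Fin n) ℝ) (y : Fin n → ℝ) :
    (M * Matrix.vecMulVec y y).trace = y ⬝ᵥ (M *ᵥ y) := by
  rw [Matrix.mul_vecMulVec, Matrix.trace_vecMulVec, dotProduct_comm]

theorem sparsity_le_of_mem_aux {n k : ℕ} (x : Fin n → ℝ)
    (h : Matrix.vecMulVec x x ∈ Spartra n k) : sparsity x ≤ k := by
  have h1 := h.1.dotProduct_mulVec_nonneg (fun i => (x i)⁻¹)
  have hs : ∑ i, (x i)⁻¹ * x i = (sparsity x : ℝ) := by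
    unfold sparsity
    rw [Finset.card_filter]
    push_cast
    refine Finset.sum_congr rfl fun i _ => ?_
    by_cases hi : x i = 0 <;> simp [hi]
  have hd : ∑ i, (x i)⁻¹ * (x i * x i * (x i)⁻¹) = (sparsity x : ℝ) := by
    rw [← hs]
    refine Finset.sum_congr rfl fun i _ => ?_
    by_cases hi : x i = 0
    · simp [hi]
    · field_simp
  have h2 : (0 : ℝ) ≤ k * sparsity x - sparsity x * sparsity x := by
    have e1 : (fun i => (x i)⁻¹) ⬝ᵥ (Matrix.diagonal (fun i => Matrix.vecMulVec x x i i) *ᵥ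
        (fun i => (x i)⁻¹)) = (sparsity x : ℝ) := by
      rw [← hd]
      simp only [dotProduct, Matrix.mulVec_diagonal, Matrix.vecMulVec_apply]
    have e2 : (fun i => (x i)⁻¹) ⬝ᵥ (Matrix.vecMulVec x x *ᵥ
        (fun i => (x i)⁻¹)) = (sparsity x : ℝ) * sparsity x := by
      rw [← trace_mul_vecMulVec_aux, Matrix.vecMulVec_mul_vecMulVec, Matrix.trace_vecMulVec,
        dotProduct_smul, dotProduct_comm x]
      simp only [dotProduct, hs, smul_eq_mul]
    rw [star_trivial, Matrix.sub_mulVec, dotProduct_sub, Matrix.smul_mulVec, dotProduct_smul,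
      e1, e2, smul_eq_mul] at h1
    exact h1
  by_contra hc
  have hc : k < sparsity x := not_le.mp hc
  have hc' : (k : ℝ) < sparsity x := by exact_mod_cast hc
  have h0 : (0 : ℝ) ≤ k := Nat.cast_nonneg k
  nlinarith

theorem rank_one_solution_exact (n k m : ℕ) (hk : 1 ≤ k)
    (K : Set (Matrix (Fin n) (Fin n) ℝ)) (hconv : Convex ℝ K)
    (hcone : ∀ c : ℝ, 0 ≤ c → ∀ X ∈ K, c • X ∈ K)
    (hQK : Qset n k ⊆ K) (hKS : K ⊆ Spartra n k)
    (C : Matrix (Fin n) (Fin n) ℝ) (A : Fin m → Matrix (Fin n) (Fin n) ℝ)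
    (b : Fin m → ℝ) (x : Fin n → ℝ)
    (hfeas : Matrix.vecMulVec x x ∈ K)
    (hfeas' : ∀ i, (A i * Matrix.vecMulVec x x).trace = b i)
    (hopt : ∀ X ∈ K, (∀ i, (A i * X).trace = b i) →
      (C * Matrix.vecMulVec x x).trace ≤ (C * X).trace) :
    sparsity x ≤ k ∧ (∀ i, x ⬝ᵥ (A i *ᵥ x) = b i) ∧
    (∀ y : Fin n → ℝ, sparsity y ≤ k → (∀ i, y ⬝ᵥ (A i *ᵥ y) = b i) →
      x ⬝ᵥ (C *ᵥ x) ≤ y ⬝ᵥ (C *ᵥ y)) ∧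
    x ⬝ᵥ (C *ᵥ x) = (C * Matrix.vecMulVec x x).trace := by
  simp only [trace_mul_vecMulVec_aux] at hfeas' hopt ⊢
  refine ⟨sparsity_le_of_mem_aux x (hKS hfeas), hfeas', fun y hy hA => ?_, trivial⟩
  have := hopt (Matrix.vecMulVec y y) (hQK ⟨y, hy, rfl⟩)
    (fun i => by rw [trace_mul_vecMulVec_aux]; exact hA i)
  rwa [trace_mul_vecMulVec_aux] at this
end

section
/- Suppose Σ ∈ 𝕊ⁿ is positive semidefinite with rank r, and let 1 ≤ k ≤ n. Let v* be the optimal value of the sparse PCA problem and v̄* the optimal value of its spartrahedron SDP relaxation. Then v̄* ≤ min{k, n/k, r} · v*. -/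
open Matrix Finset

/-- The set of objective values of the sparse PCA problem for `M`. -/
def PCAVals (n k : ℕ) (M : Matrix (Fin n) (Fin n) ℝ) : Set ℝ :=
  {v | ∃ x : Fin n → ℝ, (∑ i, (x i) ^ 2) = 1 ∧ sparsity x ≤ k ∧ v = x ⬝ᵥ (M *ᵥ x)}

/-- The set of objective values of the spartrahedron SDP relaxation for `M`. -/
def PCASDPVals (n k : ℕ) (M : Matrix (Fin n) (Fin n) ℝ) : Set ℝ :=
  {v | ∃ X ∈ Spartra n k, X.trace = 1 ∧ v = (M * X).trace}


theorem tr_nonneg {n : ℕ} (A X : Matrix (Fin n) (Fin n) ℝ) (hA : ∀ x, 0 ≤ x ⬝ᵥ (A *ᵥ x))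
    (hX : X.PosSemidef) : 0 ≤ (A * X).trace := by
  obtain ⟨B, rfl⟩ : ∃ B : Matrix (Fin n) (Fin n) ℝ, X = Bᴴ * B := by
    open scoped MatrixOrder in
    exact CStarAlgebra.nonneg_iff_eq_star_mul_self.mp hX.nonneg
  rw [← Matrix.mul_assoc, Matrix.trace_mul_comm, ← Matrix.mul_assoc, Matrix.trace]
  refine Finset.sum_nonneg fun l _ => ?_
  refine (hA (B l)).trans_eq ?_
  simp only [Matrix.diag, Matrix.mul_apply, dotProduct, Matrix.mulVec, Matrix.conjTranspose_apply,
    star_trivial, Finset.sum_mul, Finset.mul_sum]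
  conv_rhs => rw [Finset.sum_comm]
  refine Finset.sum_congr rfl fun i _ => Finset.sum_congr rfl fun j _ => by ring

theorem top_set {n : ℕ} (u : Fin n → ℝ) (k : ℕ) (hk : k ≤ n) : ∃ T : Finset (Fin n), ∃ t : ℝ,
    T.card = k ∧ 0 ≤ t ∧ (∀ i ∈ T, t ≤ |u i|) ∧ (∀ i, i ∉ T → |u i| ≤ t) := by
  induction k with
  | zero =>
    refine ⟨∅, ∑ i, |u i|, rfl, Finset.sum_nonneg fun i _ => abs_nonneg _, by simp, fun i _ => ?_⟩
    exact Finset.single_le_sum (f := fun i => |u i|) (fun i _ => abs_nonneg _) (Finset.mem_univ i)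
  | succ k ih =>
    obtain ⟨T, t, hc, ht, h1, h2⟩ := ih (by omega)
    have hne : (Tᶜ).Nonempty := by
      rw [← Finset.card_pos, Finset.card_compl, Fintype.card_fin]; omega
    obtain ⟨m, hm, hmax⟩ := Finset.exists_max_image (Tᶜ) (fun i => |u i|) hne
    rw [Finset.mem_compl] at hm
    refine ⟨insert m T, |u m|, by rw [Finset.card_insert_of_notMem hm, hc], abs_nonneg _, ?_, ?_⟩
    · intro i hi
      rcases Finset.mem_insert.mp hi with rfl | hi
      · exact le_rfl
      · exact (h2 m hm).trans (h1 i hi)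
    · intro i hi
      exact hmax i (by simp at hi ⊢; exact hi.2)

theorem key_quad {n : ℕ} (u : Fin n → ℝ) (k : ℕ) (hk1 : 1 ≤ k) (T : Finset (Fin n)) (t : ℝ)
    (hT : T.card = k) (ht : 0 ≤ t) (h1 : ∀ i ∈ T, t ≤ |u i|) (h2 : ∀ i, i ∉ T → |u i| ≤ t) :
    ∃ a : Fin n → ℝ, ∀ x : Fin n → ℝ, (∑ i, u i * x i) ^ 2 ≤
      (∑ i ∈ T, u i ^ 2) * (∑ i, (1 - a i ^ 2) * x i ^ 2 + (∑ i, a i * x i) ^ 2 / k) := by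
  classical
  have hk0 : (0 : ℝ) < k := by exact_mod_cast hk1
  have h1' : ∀ i ∈ T, t ^ 2 ≤ u i ^ 2 := fun i hi => by
    rw [← sq_abs (u i)]; exact pow_le_pow_left₀ ht (h1 i hi) 2
  have h2' : ∀ i, i ∉ T → u i ^ 2 ≤ t ^ 2 := fun i hi => by
    rw [← sq_abs (u i)]; exact pow_le_pow_left₀ (abs_nonneg _) (h2 i hi) 2
  set a : Fin n → ℝ := fun i => if i ∈ T then t / u i else u i / t with ha
  have ha1 : ∀ i, a i ^ 2 ≤ 1 := by
    intro i
    by_cases hi : i ∈ T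
    · simp only [ha, hi, if_true, div_pow]
      exact div_le_one_of_le₀ (h1' i hi) (sq_nonneg _)
    · simp only [ha, hi, if_false, div_pow]
      exact div_le_one_of_le₀ (h2' i hi) (sq_nonneg _)
  refine ⟨a, fun x => ?_⟩
  set A := ∑ i, a i * x i
  set F := ∑ i ∈ T, (1 - a i ^ 2) * x i ^ 2 with hF
  set G := ∑ i ∈ T, (u i ^ 2 - t ^ 2) with hG
  set W := ∑ i ∈ T, (u i - t * a i) * x i with hW
  have hFF : F ≤ ∑ i, (1 - a i ^ 2) * x i ^ 2 :=
    Finset.sum_le_sum_of_subset_of_nonneg (Finset.subset_univ _)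
      fun i _ _ => mul_nonneg (by linarith [ha1 i]) (sq_nonneg _)
  have hF0 : 0 ≤ F := Finset.sum_nonneg fun i _ => mul_nonneg (by linarith [ha1 i]) (sq_nonneg _)
  have hG0 : 0 ≤ G := Finset.sum_nonneg fun i hi => by linarith [h1' i hi]
  have hWFG : W ^ 2 ≤ F * G := by
    refine Finset.sum_sq_le_sum_mul_sum_of_sq_le_mul T
      (fun i _ => mul_nonneg (by linarith [ha1 i]) (sq_nonneg _))
      (fun i hi => by linarith [h1' i hi]) fun i hi => le_of_eq ?_
    simp only [ha, hi, if_true]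
    by_cases hu : u i = 0
    · have : t = 0 := by
        have := h1 i hi
        rw [hu, abs_zero] at this; linarith
      simp [hu, this]
    · field_simp
  have hl : ∑ i ∈ T, u i ^ 2 = k * t ^ 2 + G := by
    rw [hG, Finset.sum_sub_distrib]; simp [hT]
  have hux : ∑ i, u i * x i = t * A + W := by
    have : W = ∑ i, (u i - t * a i) * x i := by
      refine Finset.sum_subset (Finset.subset_univ _) fun i _ hi => ?_
      simp only [ha, hi, if_false]
      by_cases h0 : t = 0
      · have : u i = 0 := by
          have := h2 i hi
          rw [h0] at this; exact abs_eq_zero.mp (le_antisymm this (abs_nonneg _))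
        simp [this]
      · field_simp; ring
    rw [this, Finset.mul_sum, ← Finset.sum_add_distrib]
    exact Finset.sum_congr rfl fun i _ => by ring
  rw [hux, hl]
  have hkt : 0 ≤ k * t ^ 2 + G := by positivity
  refine le_trans ?_ (mul_le_mul_of_nonneg_left (add_le_add_left hFF _) hkt)
  have hcross : 2 * (t * A * W) ≤ k * t ^ 2 * F + G * (A ^ 2 / k) := by
    have hQ : 0 ≤ k * t ^ 2 * F := by positivity
    have hR : 0 ≤ G * (A ^ 2 / k) := by positivity
    refine le_of_abs_le (abs_le_of_sq_le_sq ?_ (add_nonneg hQ hR))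
    have e1 : (k * t ^ 2 * F) * (G * (A ^ 2 / k)) = t ^ 2 * A ^ 2 * (F * G) := by
      field_simp
    have e2 : t ^ 2 * A ^ 2 * W ^ 2 ≤ t ^ 2 * A ^ 2 * (F * G) :=
      mul_le_mul_of_nonneg_left hWFG (by positivity)
    nlinarith [sq_nonneg (k * t ^ 2 * F - G * (A ^ 2 / k))]
  have : (k * t ^ 2 + G) * (F + A ^ 2 / k) = t ^ 2 * A ^ 2 + G * F + (k * t ^ 2 * F + G * (A ^ 2 / k)) := by
    field_simp; ring
  rw [this]; nlinarith

theorem rank_one {n : ℕ} (u : Fin n → ℝ) (k : ℕ) (hk1 : 1 ≤ k) (hkn : k ≤ n)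
    (X : Matrix (Fin n) (Fin n) ℝ) (hX : X ∈ Spartra n k) (hX1 : X.trace = 1) :
    ∃ T : Finset (Fin n), T.card = k ∧ (vecMulVec u u * X).trace ≤ ∑ i ∈ T, u i ^ 2 := by
  obtain ⟨T, t, hT, ht, h1, h2⟩ := top_set u k hkn
  obtain ⟨a, ha⟩ := key_quad u k hk1 T t hT ht h1 h2
  have hk0 : (0 : ℝ) < k := by exact_mod_cast hk1
  refine ⟨T, hT, ?_⟩
  set l := ∑ i ∈ T, u i ^ 2 with hl
  have hl0 : 0 ≤ l := Finset.sum_nonneg fun i _ => sq_nonneg _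
  have e1 := tr_nonneg (l • (1 - diagonal (fun i => a i ^ 2) + (k:ℝ)⁻¹ • vecMulVec a a) - vecMulVec u u) X
    (fun x => by
      have := ha x
      have e : x ⬝ᵥ ((l • (1 - diagonal (fun i => a i ^ 2) + (k:ℝ)⁻¹ • vecMulVec a a) - vecMulVec u u) *ᵥ x)
        = l * (∑ i, (1 - a i ^ 2) * x i ^ 2 + (∑ i, a i * x i) ^ 2 / k) - (∑ i, u i * x i) ^ 2 := by
        have q : ∀ v : Fin n → ℝ, x ⬝ᵥ (vecMulVec v v *ᵥ x) = (∑ i, v i * x i) ^ 2 := by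
          intro v
          rw [vecMulVec_mulVec]
          simp [dotProduct, sq, Finset.mul_sum, mul_comm, mul_left_comm]
        have d : x ⬝ᵥ (diagonal (fun i => a i ^ 2) *ᵥ x) = ∑ i, a i ^ 2 * x i ^ 2 := by
          simp only [dotProduct, mulVec_diagonal]
          exact Finset.sum_congr rfl fun i _ => by ring
        have o : x ⬝ᵥ x = ∑ i, x i ^ 2 := by
          simp [dotProduct, sq]
        simp only [sub_mulVec, add_mulVec, smul_mulVec, one_mulVec, dotProduct_sub, dotProduct_add,
          dotProduct_smul, q, d, o, sub_mul, one_mul, Finset.sum_sub_distrib, smul_eq_mul]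
        ring
      rw [e]; linarith) hX.2
  have e2 := tr_nonneg (vecMulVec a a) _ (fun x => by
    simpa using (posSemidef_vecMulVec_self_star a).dotProduct_mulVec_nonneg x) hX.1
  have dg : ∀ c : ℝ, (vecMulVec a a * (c • diagonal (fun i => X i i))).trace = c * ∑ i, a i ^ 2 * X i i := by
    intro c
    simp [trace, vecMulVec_apply, sq, Finset.mul_sum]
  have dg2 : (diagonal (fun i => a i ^ 2) * X).trace = ∑ i, a i ^ 2 * X i i := by
    simp [trace]
  simp only [mul_sub, trace_sub, dg] at e2
  simp only [sub_mul, add_mul, smul_mul, one_mul, trace_sub, trace_add, trace_smul, dg2, hX1, smul_eq_mul] at e1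
  have : (k:ℝ)⁻¹ * (vecMulVec a a * X).trace ≤ ∑ i, a i ^ 2 * X i i := by
    rw [inv_mul_le_iff₀ hk0]; linarith
  nlinarith

theorem decomp {n : ℕ} (M : Matrix (Fin n) (Fin n) ℝ) (hM : M.PosSemidef) :
    ∃ (S : Finset (Fin n)) (f : Fin n → Fin n → ℝ), S.card = M.rank ∧
      M = ∑ i ∈ S, vecMulVec (f i) (f i) := by
  classical
  set ev := hM.isHermitian.eigenvalues with hev
  set U : Matrix (Fin n) (Fin n) ℝ := hM.isHermitian.eigenvectorUnitary.1 with hU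
  refine ⟨Finset.univ.filter fun i => ev i ≠ 0, fun i j => √(ev i) * U j i, ?_, ?_⟩
  · rw [hM.isHermitian.rank_eq_card_non_zero_eigs, Fintype.card_subtype]
  · have := hM.isHermitian.spectral_theorem
    rw [Unitary.conjStarAlgAut_apply] at this
    conv_lhs => rw [this]
    ext p q
    rw [Finset.sum_filter_of_ne]
    · simp [Matrix.mul_apply, Matrix.sum_apply, vecMulVec_apply, Matrix.diagonal_apply]
      refine Finset.sum_congr rfl fun i _ => ?_
      have := Real.mul_self_sqrt (hM.eigenvalues_nonneg i)
      rw [← hev] at this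
      have hp : ∀ p, (hM.isHermitian.eigenvectorBasis i).ofLp p = U p i := fun p => rfl
      rw [hp, hp, ← hev]
      linear_combination (-(U p i * U q i)) * this
    · intro i _ h h0
      apply h
      ext; simp [vecMulVec_apply, h0]

theorem quad_vv {n : ℕ} (x v : Fin n → ℝ) :
    x ⬝ᵥ (vecMulVec v v *ᵥ x) = (∑ i, v i * x i) ^ 2 := by
  rw [vecMulVec_mulVec]
  simp [dotProduct, sq, Finset.mul_sum, mul_comm, mul_left_comm]

theorem homog {n k : ℕ} (M : Matrix (Fin n) (Fin n) ℝ) (v : ℝ) (hv : v ∈ upperBounds (PCAVals n k M))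
    (y : Fin n → ℝ) (hy : sparsity y ≤ k) : y ⬝ᵥ (M *ᵥ y) ≤ v * ∑ i, y i ^ 2 := by
  set s := ∑ i, y i ^ 2 with hs
  have hs0 : 0 ≤ s := Finset.sum_nonneg fun i _ => sq_nonneg _
  rcases hs0.eq_or_lt with h0 | hpos
  · have : y = 0 := by
      ext i
      have := (Finset.sum_eq_zero_iff_of_nonneg (fun i _ => sq_nonneg (y i))).mp h0.symm i (Finset.mem_univ i)
      simpa using this
    rw [← h0, this]; simp
  · have hc : ((√s)⁻¹) ^ 2 = s⁻¹ := by rw [inv_pow, Real.sq_sqrt hs0]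
    have := hv (show s⁻¹ * (y ⬝ᵥ (M *ᵥ y)) ∈ PCAVals n k M from
      ⟨(√s)⁻¹ • y, by
        simp only [Pi.smul_apply, smul_eq_mul, mul_pow, hc]
        rw [← Finset.mul_sum, ← hs, inv_mul_cancel₀ hpos.ne'],
       by
        refine le_trans (Finset.card_le_card ?_) hy
        intro i; simp only [Finset.mem_filter, Finset.mem_univ, true_and, Pi.smul_apply, smul_eq_mul]
        exact right_ne_zero_of_mul,
       by
        rw [mulVec_smul, dotProduct_smul, smul_dotProduct, smul_eq_mul, smul_eq_mul, ← mul_assoc, ← sq, hc]⟩)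
    rw [inv_mul_le_iff₀ hpos] at this
    linarith

theorem bound_nk {n k : ℕ} (hk : 1 ≤ k) (hkn : k ≤ n) (M : Matrix (Fin n) (Fin n) ℝ)
    (hM : M.PosSemidef) (v : ℝ)
    (H : ∀ y : Fin n → ℝ, sparsity y ≤ k → y ⬝ᵥ (M *ᵥ y) ≤ v * ∑ i, y i ^ 2)
    (x : Fin n → ℝ) : x ⬝ᵥ (M *ᵥ x) ≤ (n : ℝ) / k * v * ∑ i, x i ^ 2 := by
  classical
  have : NeZero n := ⟨by omega⟩
  have hk0 : (0 : ℝ) < k := by exact_mod_cast hk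
  obtain ⟨S, f, -, hS⟩ := decomp M hM
  have hq : ∀ y : Fin n → ℝ, y ⬝ᵥ (M *ᵥ y) = ∑ s ∈ S, (∑ i, f s i * y i) ^ 2 := by
    intro y
    rw [hS, Matrix.sum_mulVec, dotProduct_sum]
    exact Finset.sum_congr rfl fun s _ => quad_vv _ _
  have hcard : (Finset.univ.filter fun m : Fin n => m.val < k).card = k := by
    rw [Fin.card_filter_val_lt]; omega
  let y : Fin n → Fin n → ℝ := fun j i => if (i - j).val < k then x i else 0
  have hc1 : ∀ i : Fin n, (Finset.univ.filter fun j : Fin n => (i - j).val < k).card = k := by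
    intro i
    refine Eq.trans ?_ hcard
    refine Finset.card_bij' (fun j _ => i - j) (fun j _ => i - j) ?_ ?_ ?_ ?_ <;> simp
  have hc2 : ∀ j : Fin n, (Finset.univ.filter fun i : Fin n => (i - j).val < k).card = k := by
    intro j
    refine Eq.trans ?_ hcard
    refine Finset.card_bij' (fun i _ => i - j) (fun i _ => i + j) ?_ ?_ ?_ ?_ <;> simp
  have hysp : ∀ j, sparsity (y j) ≤ k := by
    intro j
    rw [← hc2 j]
    refine Finset.card_le_card fun i => ?_
    simp only [Finset.mem_filter, Finset.mem_univ, true_and, y]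
    intro h; by_contra h'; simp [h'] at h
  have hsum : ∀ g : Fin n → ℝ, ∑ j, ∑ i, (if (i - j).val < k then g i else 0) = k * ∑ i, g i := by
    intro g
    rw [Finset.sum_comm, Finset.mul_sum]
    refine Finset.sum_congr rfl fun i _ => ?_
    rw [← Finset.sum_filter, Finset.sum_const, hc1, nsmul_eq_mul]
  have h2 : ∑ j, ∑ i, (y j i) ^ 2 = k * ∑ i, x i ^ 2 := by
    rw [← hsum]
    refine Finset.sum_congr rfl fun j _ => Finset.sum_congr rfl fun i _ => ?_
    simp only [y]; split_ifs <;> simp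
  have h3 : ∀ s, ∑ j, ∑ i, f s i * y j i = k * ∑ i, f s i * x i := by
    intro s
    rw [← hsum]
    refine Finset.sum_congr rfl fun j _ => Finset.sum_congr rfl fun i _ => ?_
    simp only [y]; split_ifs <;> simp
  have h4 : (k:ℝ) ^ 2 * (x ⬝ᵥ (M *ᵥ x)) ≤ n * ∑ j, y j ⬝ᵥ (M *ᵥ y j) := by
    simp only [hq]
    rw [Finset.sum_comm, Finset.mul_sum, Finset.mul_sum]
    refine Finset.sum_le_sum fun s _ => ?_
    rw [← mul_pow, ← h3]
    simpa using sq_sum_le_card_mul_sum_sq (s := Finset.univ) (f := fun j => ∑ i, f s i * y j i)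
  have h5 : ∑ j, y j ⬝ᵥ (M *ᵥ y j) ≤ v * (k * ∑ i, x i ^ 2) := by
    rw [← h2, Finset.mul_sum]
    exact Finset.sum_le_sum fun j _ => H _ (hysp j)
  have h6 : (k:ℝ) ^ 2 * (x ⬝ᵥ (M *ᵥ x)) ≤ n * (v * (k * ∑ i, x i ^ 2)) :=
    h4.trans (mul_le_mul_of_nonneg_left h5 (Nat.cast_nonneg n))
  refine le_of_mul_le_mul_left (h6.trans_eq ?_) (pow_pos hk0 2)
  field_simp

theorem spca_approximation_ratio (n k : ℕ) (hk : 1 ≤ k) (hkn : k ≤ n)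
    (M : Matrix (Fin n) (Fin n) ℝ) (hM : M.PosSemidef)
    (vstar vbar : ℝ)
    (hv : IsGreatest (PCAVals n k M) vstar)
    (hvbar : IsGreatest (PCASDPVals n k M) vbar) :
    vbar ≤ min (k : ℝ) (min ((n : ℝ) / (k : ℝ)) (M.rank : ℝ)) * vstar := by
  classical
  have hk0 : (0 : ℝ) < k := by exact_mod_cast hk
  have H := homog M vstar hv.2
  have hv0 : 0 ≤ vstar := by
    obtain ⟨x, -, -, rfl⟩ := hv.1
    simpa using hM.dotProduct_mulVec_nonneg x
  obtain ⟨X, hX, hX1, rfl⟩ := hvbar.1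
  have Hd : ∀ i, M i i ≤ vstar := by
    intro i
    have := H (Pi.single i 1) (by
      refine le_trans (Finset.card_le_card (t := {i}) ?_) (by simpa using hk)
      intro j
      simp only [Finset.mem_filter, Finset.mem_univ, true_and, Finset.mem_singleton]
      intro h; by_contra h'; simp [h'] at h)
    simpa [Pi.single_apply] using this
  have b1 : (M * X).trace ≤ k * vstar := by
    have e := tr_nonneg M _ (fun x => by simpa using hM.dotProduct_mulVec_nonneg x) hX.1
    have dg : (M * ((k : ℝ) • diagonal (fun i => X i i))).trace = k * ∑ i, M i i * X i i := by
      simp [trace, Finset.mul_sum]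
    rw [mul_sub, trace_sub, dg] at e
    have : ∑ i, M i i * X i i ≤ vstar * ∑ i, X i i := by
      rw [Finset.mul_sum]
      exact Finset.sum_le_sum fun i _ => mul_le_mul_of_nonneg_right (Hd i) hX.2.diag_nonneg
    have h1 : ∑ i, X i i = 1 := hX1
    rw [h1, mul_one] at this
    nlinarith
  have b2 : (M * X).trace ≤ (n : ℝ) / k * vstar := by
    have e := tr_nonneg (((n : ℝ) / k * vstar) • 1 - M) X (fun x => by
      have := bound_nk hk hkn M hM vstar H x
      have o : x ⬝ᵥ x = ∑ i, x i ^ 2 := by simp [dotProduct, sq]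
      rw [sub_mulVec, smul_mulVec, one_mulVec, dotProduct_sub, dotProduct_smul, o, smul_eq_mul]
      linarith) hX.2
    rw [sub_mul, smul_mul, one_mul, trace_sub, trace_smul, hX1, smul_eq_mul] at e
    linarith
  have b3 : (M * X).trace ≤ M.rank * vstar := by
    obtain ⟨S, f, hc, hS⟩ := decomp M hM
    rw [← hc]
    have e : (M * X).trace = ∑ s ∈ S, (vecMulVec (f s) (f s) * X).trace := by
      conv_lhs => rw [hS]
      rw [Finset.sum_mul, trace_sum]
    rw [e, ← nsmul_eq_mul]
    refine Finset.sum_le_card_nsmul _ _ _ fun s hs => ?_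
    obtain ⟨T, hT, hle⟩ := rank_one (f s) k hk hkn X hX hX1
    refine hle.trans ?_
    have hy := H (fun i => if i ∈ T then f s i else 0) (by
      rw [← hT]
      refine Finset.card_le_card fun i => ?_
      simp only [Finset.mem_filter, Finset.mem_univ, true_and]
      intro h; by_contra h'; simp [h'] at h)
    set l := ∑ i ∈ T, f s i ^ 2 with hl
    have hl0 : 0 ≤ l := Finset.sum_nonneg fun i _ => sq_nonneg _
    have e1 : ∑ i, (if i ∈ T then f s i else 0) ^ 2 = l := by
      simp [ite_pow, hl]
    have e2 : l ^ 2 ≤ (fun i => if i ∈ T then f s i else 0) ⬝ᵥ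
        (M *ᵥ (fun i => if i ∈ T then f s i else 0)) := by
      conv_rhs => rw [hS]
      rw [Matrix.sum_mulVec, dotProduct_sum]
      simp only [quad_vv]
      have h0 := Finset.single_le_sum (f := fun s' => (∑ i, f s' i * (if i ∈ T then f s i else 0)) ^ 2)
        (fun i _ => sq_nonneg _) hs
      refine le_trans (le_of_eq ?_) h0
      simp [hl, sq]
    rw [e1] at hy
    rcases hl0.eq_or_lt with h0 | hpos
    · rw [← h0]; exact hv0
    · nlinarith
  rcases min_choice (k : ℝ) (min ((n : ℝ) / (k : ℝ)) (M.rank : ℝ)) with h | h <;> rw [h]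
  · exact b1
  · rcases min_choice ((n : ℝ) / (k : ℝ)) (M.rank : ℝ) with h | h <;> rw [h]
    · exact b2
    · exact b3
end

section
/- Let Σ ∈ 𝕊ⁿ be arbitrary (not necessarily positive semidefinite), let v* and v̄* be the sparse PCA value and its SDP relaxation value, respectively. Let r = n − mult(λ_min(Σ)) be the co-multiplicity of the smallest eigenvalue of Σ, and let q = min{k, n/k, r}. Then v̄* ≤ q·v* − (q−1)·λ_min(Σ). -/
open Matrix Finset

lemma psd_cs {n : ℕ} {X : Matrix (Fin n) (Fin n) ℝ} (hX : X.PosSemidef) (x y : Fin n → ℝ) :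
    (x ⬝ᵥ X *ᵥ y) ^ 2 ≤ (x ⬝ᵥ X *ᵥ x) * (y ⬝ᵥ X *ᵥ y) := by
  have hs : y ⬝ᵥ X *ᵥ x = x ⬝ᵥ X *ᵥ y := by
    have h1 : Xᵀ = X := by simpa using hX.1.eq
    rw [dotProduct_mulVec, ← mulVec_transpose, h1, dotProduct_comm]
  have := discrim_le_zero (a := y ⬝ᵥ X *ᵥ y) (b := 2 * (x ⬝ᵥ X *ᵥ y)) (c := x ⬝ᵥ X *ᵥ x) (by
    intro t
    have h := hX.dotProduct_mulVec_nonneg (x + t • y)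
    simp only [star_trivial, mulVec_add, mulVec_smul, add_dotProduct, dotProduct_add, smul_dotProduct, dotProduct_smul, smul_eq_mul, hs] at h
    linarith)
  unfold discrim at this
  nlinarith

lemma exists_top {n : ℕ} (p : Fin n → ℝ) (k : ℕ) (hk : k ≤ n) :
    ∃ S : Finset (Fin n), S.card = k ∧ ∀ i ∈ S, ∀ j ∉ S, p j ≤ p i := by
  induction k with
  | zero => exact ⟨∅, by simp⟩
  | succ k ih =>
    obtain ⟨S, hS, h⟩ := ih (by omega)
    have hne : (Sᶜ).Nonempty := by
      rw [← Finset.card_pos, Finset.card_compl, Fintype.card_fin]; omega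
    obtain ⟨m, hm, hmax⟩ := Finset.exists_max_image _ p hne
    have hm' : m ∉ S := by simpa using hm
    refine ⟨insert m S, by rw [Finset.card_insert_of_notMem hm', hS], ?_⟩
    intro i hi j hj
    simp only [Finset.mem_insert, not_or] at hi hj
    rcases hi with rfl | hi
    · exact hmax j (by simpa using hj.2)
    · exact h i hi j hj.2

lemma top_bound {n : ℕ} (p θ : Fin n → ℝ) (hp : ∀ i, 0 ≤ p i) (k : ℕ) (hk1 : 1 ≤ k) (hk : k ≤ n)
    (h0 : ∀ i, 0 ≤ θ i) (h1 : ∀ i, θ i ≤ 1) (hs : ∑ i, θ i ≤ k) :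
    ∃ S : Finset (Fin n), S.card = k ∧ ∑ i, p i * θ i ≤ ∑ i ∈ S, p i := by
  obtain ⟨S, hS, h⟩ := exists_top p k hk
  refine ⟨S, hS, ?_⟩
  obtain ⟨m, hm, hmin⟩ := Finset.exists_min_image S p (Finset.card_pos.1 (by omega))
  have e1 : ∀ i, (p i - p m) * θ i ≤ if i ∈ S then p i - p m else 0 := by
    intro i
    split_ifs with hi
    · have := hmin i hi
      nlinarith [h1 i]
    · have := h m hm i hi
      nlinarith [h0 i]
  have e2 := Finset.sum_le_sum (fun i (_ : i ∈ Finset.univ) => e1 i)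
  rw [← Finset.sum_filter] at e2
  simp only [Finset.filter_mem_eq_inter, Finset.univ_inter, sub_mul, Finset.sum_sub_distrib, Finset.sum_const, hS, nsmul_eq_mul, ← Finset.mul_sum] at e2
  nlinarith [hp m]

lemma diag_bound {n k : ℕ} {X : Matrix (Fin n) (Fin n) ℝ}
    (hK : ((k : ℝ) • Matrix.diagonal (fun i => X i i) - X).PosSemidef) :
    ∀ g : Fin n → ℝ, g ⬝ᵥ X *ᵥ g ≤ k * ∑ i, X i i * g i ^ 2 := by
  intro g
  have h := hK.dotProduct_mulVec_nonneg g
  simp only [star_trivial, sub_mulVec, dotProduct_sub, smul_mulVec, dotProduct_smul, smul_eq_mul] at h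
  have : g ⬝ᵥ (diagonal fun i => X i i) *ᵥ g = ∑ i, X i i * g i ^ 2 := by
    simp only [dotProduct, mulVec_diagonal]
    exact Finset.sum_congr rfl fun i _ => by ring
  rw [this] at h; linarith

lemma rank_one_s16 {n k : ℕ} {X : Matrix (Fin n) (Fin n) ℝ} (hX : X.PosSemidef)
    (hK : ((k : ℝ) • Matrix.diagonal (fun i => X i i) - X).PosSemidef) (htr : X.trace = 1)
    (v : Fin n → ℝ) : ∃ θ : Fin n → ℝ, (∀ i, 0 ≤ θ i) ∧ (∀ i, θ i ≤ 1) ∧ ∑ i, θ i ≤ k ∧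
      v ⬝ᵥ X *ᵥ v ≤ ∑ i, v i ^ 2 * θ i := by
  have hD := diag_bound hK
  set a := v ⬝ᵥ X *ᵥ v with ha
  have ha0 : 0 ≤ a := by simpa using hX.dotProduct_mulVec_nonneg v
  rcases ha0.eq_or_lt with h | hpos
  · exact ⟨fun _ => 0, by simp, by simp, by simp, by simp [← h]⟩
  set c := X *ᵥ v with hc
  have hd : ∀ i, 0 ≤ X i i := fun i => hX.diag_nonneg
  have hci : ∀ i, c i ^ 2 ≤ X i i * a := by
    intro i
    have := psd_cs hX (Pi.single i 1) v
    simpa using this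
  have hz : ∀ i, X i i = 0 → c i = 0 := by
    intro i hi
    have := hci i
    rw [hi, zero_mul] at this
    exact pow_eq_zero_iff (two_ne_zero) |>.1 (le_antisymm this (sq_nonneg _))
  have hsum : ∑ i, c i ^ 2 / X i i ≤ k * a := by
    have h1 := psd_cs hX (fun i => c i / X i i) v
    have h2 := hD (fun i => c i / X i i)
    have e1 : (fun i => c i / X i i) ⬝ᵥ c = ∑ i, c i ^ 2 / X i i :=
      Finset.sum_congr rfl fun i _ => by ring
    have e2 : ∑ i, X i i * (c i / X i i) ^ 2 = ∑ i, c i ^ 2 / X i i := by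
      refine Finset.sum_congr rfl fun i _ => ?_
      by_cases hi : X i i = 0
      · simp [hi]
      · field_simp
    rw [← hc, e1, ← ha] at h1
    rw [e2] at h2
    have h0 : 0 ≤ ∑ i, c i ^ 2 / X i i := Finset.sum_nonneg fun i _ => div_nonneg (sq_nonneg _) (hd i)
    rcases h0.eq_or_lt with h | h
    · rw [← h]; positivity
    · have : (∑ i, c i ^ 2 / X i i) ^ 2 ≤ (k * ∑ i, c i ^ 2 / X i i) * a :=
        h1.trans (mul_le_mul_of_nonneg_right h2 ha0)
      nlinarith
  refine ⟨fun i => c i ^ 2 / X i i / a, fun i => div_nonneg (div_nonneg (sq_nonneg _) (hd i)) ha0, ?_, ?_, ?_⟩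
  · intro i
    change c i ^ 2 / X i i / a ≤ 1
    rw [div_div]
    exact div_le_one_of_le₀ (hci i) (mul_nonneg (hd i) ha0)
  · rw [← Finset.sum_div, div_le_iff₀ hpos]; exact hsum
  · have hcs := Finset.sum_sq_le_sum_mul_sum_of_sq_le_mul Finset.univ (r := fun i => v i * c i)
      (f := fun i => v i ^ 2 * (c i ^ 2 / X i i)) (g := fun i => X i i)
      (fun i _ => mul_nonneg (sq_nonneg _) (div_nonneg (sq_nonneg _) (hd i))) (fun i _ => hd i)
      (fun i _ => by
        apply le_of_eq
        by_cases hi : X i i = 0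
        · simp [hi, hz i hi]
        · field_simp)
    have ht : ∑ i, X i i = 1 := htr
    rw [ht, mul_one] at hcs
    have e : ∑ i, v i * c i = a := rfl
    rw [e] at hcs
    have : ∑ i, v i ^ 2 * (c i ^ 2 / X i i / a) = (∑ i, v i ^ 2 * (c i ^ 2 / X i i)) / a := by
      rw [Finset.sum_div]; exact Finset.sum_congr rfl fun i _ => by ring
    rw [this, le_div_iff₀ hpos]; nlinarith

lemma quad_expand {n : ℕ} (G : Matrix (Fin n) (Fin n) ℝ) (c : Fin n → ℝ) (u : Fin n → Fin n → ℝ)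
    (hG : ∀ a b, G a b = ∑ i, c i * (u i a * u i b)) (y : Fin n → ℝ) :
    y ⬝ᵥ G *ᵥ y = ∑ i, c i * (u i ⬝ᵥ y) ^ 2 := by
  simp only [dotProduct, mulVec, hG, sq, Finset.sum_mul, Finset.mul_sum]
  rw [Finset.sum_congr rfl fun a _ => Finset.sum_comm, Finset.sum_comm]
  refine Finset.sum_congr rfl fun i _ => ?_
  rw [Finset.sum_comm]
  refine Finset.sum_congr rfl fun a _ => Finset.sum_congr rfl fun b _ => by ring

lemma trace_expand {n : ℕ} (G X : Matrix (Fin n) (Fin n) ℝ) (c : Fin n → ℝ) (u : Fin n → Fin n → ℝ)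
    (hG : ∀ a b, G a b = ∑ i, c i * (u i a * u i b)) :
    (G * X).trace = ∑ i, c i * (u i ⬝ᵥ X *ᵥ u i) := by
  simp only [Matrix.trace, Matrix.diag, Matrix.mul_apply, dotProduct, mulVec, hG, Finset.sum_mul, Finset.mul_sum]
  rw [Finset.sum_congr rfl fun a _ => Finset.sum_comm, Finset.sum_comm]
  refine Finset.sum_congr rfl fun i _ => ?_
  rw [Finset.sum_comm]
  refine Finset.sum_congr rfl fun a _ => Finset.sum_congr rfl fun b _ => by ring

lemma core_top {n k : ℕ} (hk : 1 ≤ k) (hkn : k ≤ n) (u : Fin n → Fin n → ℝ) (μ : Fin n → ℝ)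
    (hμ : ∀ i, 0 ≤ μ i) (w : ℝ) (hw0 : 0 ≤ w)
    (hw : ∀ y : Fin n → ℝ, sparsity y ≤ k → ∑ i, μ i * (u i ⬝ᵥ y) ^ 2 ≤ w * ∑ a, y a ^ 2)
    (i : Fin n) (θ : Fin n → ℝ)
    (h0 : ∀ i, 0 ≤ θ i) (h1 : ∀ i, θ i ≤ 1) (hs : ∑ i, θ i ≤ k) :
    μ i * ∑ a, u i a ^ 2 * θ a ≤ w := by
  obtain ⟨S, hS, h⟩ := top_bound (fun a => u i a ^ 2) θ (fun a => sq_nonneg _) k hk hkn h0 h1 hs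
  refine (mul_le_mul_of_nonneg_left h (hμ i)).trans ?_
  set s := ∑ a ∈ S, u i a ^ 2 with hsd
  have hs0 : 0 ≤ s := Finset.sum_nonneg fun a _ => sq_nonneg _
  have hy := hw (fun a => if a ∈ S then u i a else 0) (by
    unfold sparsity
    rw [← hS]
    apply Finset.card_le_card
    intro a ha
    by_contra hc
    simp [hc] at ha)
  have e1 : u i ⬝ᵥ (fun a => if a ∈ S then u i a else 0) = s := by
    simp [dotProduct, hsd, sq]
  have e2 : ∑ a, (if a ∈ S then u i a else 0) ^ 2 = s := by
    simp [hsd]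
  rw [e2] at hy
  have h3 := Finset.single_le_sum (f := fun j => μ j * (u j ⬝ᵥ (fun a => if a ∈ S then u i a else 0)) ^ 2)
    (fun j _ => mul_nonneg (hμ j) (sq_nonneg _)) (Finset.mem_univ i)
  simp only [e1] at h3
  rcases hs0.eq_or_lt with hz | hp
  · rw [← hz]; simpa using hw0
  · have := h3.trans hy
    nlinarith

theorem spca_lower_bound_general (n k : ℕ) (hn : 1 ≤ n) (hk : 1 ≤ k) (hkn : k ≤ n)
    (M : Matrix (Fin n) (Fin n) ℝ) (hM : M.IsHermitian)
    (lam : ℝ) (hlam : IsLeast (Set.range hM.eigenvalues) lam)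
    (mult r : ℕ)
    (hmult : mult = (Finset.univ.filter fun i => hM.eigenvalues i = lam).card)
    (hr : r = n - mult)
    (q : ℝ) (hq : q = min (k : ℝ) (min ((n : ℝ) / (k : ℝ)) (r : ℝ)))
    (vstar vbar : ℝ)
    (hv : IsGreatest (PCAVals n k M) vstar)
    (hvbar : IsGreatest (PCASDPVals n k M) vbar) :
    vbar ≤ q * vstar - (q - 1) * lam := by
  obtain ⟨X, ⟨hK, hX⟩, htr, rfl⟩ := hvbar.1
  set ev := hM.eigenvalues with hev
  have hevle : ∀ i, lam ≤ ev i := fun i => hlam.2 ⟨i, rfl⟩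
  set u : Fin n → Fin n → ℝ := fun i a => (hM.eigenvectorBasis i) a with hu
  have hI : ∀ a b, (1 : Matrix (Fin n) (Fin n) ℝ) a b = ∑ i, (1 : ℝ) * (u i a * u i b) := by
    intro a b
    have h : (hM.eigenvectorUnitary : Matrix (Fin n) (Fin n) ℝ) * star (hM.eigenvectorUnitary : Matrix (Fin n) (Fin n) ℝ) = 1 :=
      Unitary.coe_mul_star_self _
    rw [← h]
    simp [Matrix.mul_apply, Matrix.star_apply, hu]
  have hS : ∀ a b, M a b = ∑ i, ev i * (u i a * u i b) := by
    intro a b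
    have h := hM.spectral_theorem
    have h2 := congrFun (congrFun h a) b
    rw [h2, Unitary.conjStarAlgAut_apply, Matrix.mul_apply]
    refine Finset.sum_congr rfl fun i _ => ?_
    simp [Matrix.mul_diagonal, Matrix.star_apply, hu, hev]
    ring
  have hone : ∀ i, ∑ a, u i a ^ 2 = 1 := by
    intro i
    have h := hM.eigenvectorBasis.orthonormal.1 i
    rw [EuclideanSpace.norm_eq, Real.sqrt_eq_one] at h
    simpa using h
  set μ : Fin n → ℝ := fun i => ev i - lam with hμd
  have hμ : ∀ i, 0 ≤ μ i := fun i => sub_nonneg.2 (hevle i)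
  have hyy : ∀ y : Fin n → ℝ, ∑ a, y a ^ 2 = ∑ i, (u i ⬝ᵥ y) ^ 2 := by
    intro y
    have := quad_expand 1 (fun _ => 1) u hI y
    simp only [one_mulVec, one_mul] at this
    rw [← this]
    simp [dotProduct, sq]
  have hquad : ∀ y : Fin n → ℝ, ∑ i, μ i * (u i ⬝ᵥ y) ^ 2 = y ⬝ᵥ M *ᵥ y - lam * ∑ a, y a ^ 2 := by
    intro y
    rw [hyy, quad_expand M ev u hS y, Finset.mul_sum, ← Finset.sum_sub_distrib]
    exact Finset.sum_congr rfl fun i _ => by simp only [hμd]; ring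
  have hT1 : ∑ i, u i ⬝ᵥ X *ᵥ u i = 1 := by
    have := trace_expand 1 X (fun _ => 1) u hI
    simp only [one_mul, htr] at this
    exact this.symm
  have hTM : (M * X).trace = lam + ∑ i, μ i * (u i ⬝ᵥ X *ᵥ u i) := by
    rw [trace_expand M X ev u hS]
    simp only [hμd, sub_mul, Finset.sum_sub_distrib, ← Finset.mul_sum, hT1]
    ring
  set w := vstar - lam with hwd
  have hw : ∀ y : Fin n → ℝ, sparsity y ≤ k → ∑ i, μ i * (u i ⬝ᵥ y) ^ 2 ≤ w * ∑ a, y a ^ 2 := by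
    intro y hy
    rw [hquad]
    have h0 : 0 ≤ ∑ a, y a ^ 2 := Finset.sum_nonneg fun a _ => sq_nonneg _
    rcases h0.eq_or_lt with h | h
    · have hz : y = 0 := by
        funext a
        have := (Finset.sum_eq_zero_iff_of_nonneg (fun a _ => sq_nonneg (y a))).1 h.symm a (Finset.mem_univ a)
        simpa using this
      simp [hz]
    · set s := ∑ a, y a ^ 2 with hsd
      have hc : (Real.sqrt s)⁻¹ ^ 2 = s⁻¹ := by rw [inv_pow, Real.sq_sqrt h0]
      have hne : (Real.sqrt s)⁻¹ ≠ 0 := inv_ne_zero (Real.sqrt_pos.2 h).ne'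
      have hm := hv.2 ⟨(Real.sqrt s)⁻¹ • y, by
        simp only [Pi.smul_apply, smul_eq_mul, mul_pow, ← Finset.mul_sum, ← hsd, hc]
        exact inv_mul_cancel₀ h.ne', by
        refine le_trans (le_of_eq ?_) hy
        simp [sparsity, (Real.sqrt_pos.2 h).ne'], rfl⟩
      simp only [mulVec_smul, dotProduct_smul, smul_dotProduct, smul_eq_mul] at hm
      rw [← mul_assoc, ← sq, hc, inv_mul_le_iff₀ h] at hm
      rw [hwd]; linarith
  have hwe : ∀ a, ∑ i, μ i * u i a ^ 2 ≤ w := by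
    intro a
    have := hw (Pi.single a 1) (by
      refine le_trans ?_ hk
      unfold sparsity
      refine (Finset.card_le_card (t := {a}) ?_).trans (by simp)
      intro b hb
      by_contra hc
      simp only [Finset.mem_singleton] at hc
      simp [hc] at hb)
    simpa [Pi.single_apply, ite_pow] using this
  have hw0 : 0 ≤ w := le_trans (Finset.sum_nonneg fun i _ => mul_nonneg (hμ i) (sq_nonneg _)) (hwe ⟨0, hn⟩)
  have hkpos : (0 : ℝ) < k := by exact_mod_cast hk
  have hnpos : (0 : ℝ) < n := by exact_mod_cast hn
  have hXq : ∀ i, 0 ≤ u i ⬝ᵥ X *ᵥ u i := fun i => by simpa using hX.dotProduct_mulVec_nonneg (u i)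
  have hA : ∑ i, μ i * (u i ⬝ᵥ X *ᵥ u i) ≤ k * w := by
    calc ∑ i, μ i * (u i ⬝ᵥ X *ᵥ u i) ≤ ∑ i, μ i * (k * ∑ a, X a a * u i a ^ 2) :=
          Finset.sum_le_sum fun i _ => mul_le_mul_of_nonneg_left (diag_bound hK (u i)) (hμ i)
      _ = k * ∑ a, X a a * ∑ i, μ i * u i a ^ 2 := by
          simp only [Finset.mul_sum]
          rw [Finset.sum_comm]
          exact Finset.sum_congr rfl fun a _ => Finset.sum_congr rfl fun i _ => by ring
      _ ≤ k * ∑ a, X a a * w := by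
          refine mul_le_mul_of_nonneg_left ?_ hkpos.le
          exact Finset.sum_le_sum fun a _ => mul_le_mul_of_nonneg_left (hwe a) hX.diag_nonneg
      _ = k * w := by
          have ht : ∑ i, X i i = 1 := htr
          rw [← Finset.sum_mul, ht, one_mul]
  have hB : ∑ i, μ i * (u i ⬝ᵥ X *ᵥ u i) ≤ (n / k : ℝ) * w := by
    have hi : ∀ i, μ i ≤ (n / k : ℝ) * w := by
      intro i
      have h := core_top hk hkn u μ hμ w hw0 hw i (fun _ => (k / n : ℝ)) (fun _ => by positivity)
        (fun _ => div_le_one_of_le₀ (by exact_mod_cast hkn) hnpos.le)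
        (by simp; rw [mul_div_cancel₀ _ hnpos.ne'])
      rw [← Finset.sum_mul, hone, one_mul] at h
      rw [div_mul_eq_mul_div, le_div_iff₀ hkpos]
      rw [mul_div_assoc', div_le_iff₀ hnpos] at h
      linarith
    calc _ ≤ ∑ i, (n / k : ℝ) * w * (u i ⬝ᵥ X *ᵥ u i) :=
          Finset.sum_le_sum fun i _ => mul_le_mul_of_nonneg_right (hi i) (hXq i)
      _ = _ := by rw [← Finset.mul_sum, hT1, mul_one]
  have hC : ∑ i, μ i * (u i ⬝ᵥ X *ᵥ u i) ≤ r * w := by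
    have hi : ∀ i, μ i * (u i ⬝ᵥ X *ᵥ u i) ≤ if ev i = lam then 0 else w := by
      intro i
      split_ifs with h
      · simp [hμd, h]
      · obtain ⟨θ, h0, h1, h2, h3⟩ := rank_one_s16 hX hK htr (u i)
        exact (mul_le_mul_of_nonneg_left h3 (hμ i)).trans (core_top hk hkn u μ hμ w hw0 hw i θ h0 h1 h2)
    refine (Finset.sum_le_sum fun i _ => hi i).trans (le_of_eq ?_)
    have hcard := Finset.card_filter_add_card_filter_not (s := (Finset.univ : Finset (Fin n))) (fun i => ev i = lam)
    rw [Finset.sum_ite]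
    simp only [Finset.sum_const_zero, zero_add, Finset.sum_const, nsmul_eq_mul]
    congr 2
    simp only [Finset.card_univ, Fintype.card_fin] at hcard
    omega
  have hfin : ∑ i, μ i * (u i ⬝ᵥ X *ᵥ u i) ≤ q * w := by
    rw [hq]
    rcases min_choice (k : ℝ) (min ((n : ℝ) / (k : ℝ)) (r : ℝ)) with h | h <;> rw [h]
    · exact hA
    · rcases min_choice ((n : ℝ) / (k : ℝ)) (r : ℝ) with h | h <;> rw [h]
      · exact hB
      · exact hC
  rw [hTM]
  rw [hwd] at hfin
  linarith
end
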